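/- arXiv:2602.18687 — 3 statements merged into one kernel-verified Lean document; each statement's English description precedes it below -/
import Mathlib

section
/- Let p ∈ U ⊆ ℝⁿ and v₁,…,vₙ smooth vector fields, linearly independent at each point, with [vᵢ, vⱼ] ∈ span{vᵢ, vⱼ} at every point for all i, j. Then there exist local coordinates y₁,…,yₙ near p in which each vᵢ is proportional (by a nonvanishing smooth function) to ∂_{y_i}. -/
open Matrix

noncomputable def vbracket {n : ℕ} (V W : (Fin n → ℝ) → (Fin n → ℝ)) :
    (Fin n → ℝ) → (Fin n → ℝ) :=
  fun x => fderiv ℝ W x (V x) - fderiv ℝ V x (W x)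

noncomputable def opApply {n : ℕ} (L : (Fin n → ℝ) → Matrix (Fin n) (Fin n) ℝ)
    (ξ : (Fin n → ℝ) → (Fin n → ℝ)) : (Fin n → ℝ) → (Fin n → ℝ) :=
  fun x => (L x).mulVec (ξ x)

noncomputable def nijBr {n : ℕ} (L M : (Fin n → ℝ) → Matrix (Fin n) (Fin n) ℝ)
    (ξ η : (Fin n → ℝ) → (Fin n → ℝ)) : (Fin n → ℝ) → (Fin n → ℝ) :=
  fun x =>
    (M x).mulVec (vbracket (opApply L ξ) η x)
    + (L x).mulVec (vbracket ξ (opApply M η) x)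
    - vbracket (opApply L ξ) (opApply M η) x
    - (L x * M x).mulVec (vbracket ξ η x)

/-- The `i`-th constant coordinate vector field on `ℝⁿ`. -/
def eVF {n : ℕ} (i : Fin n) : (Fin n → ℝ) → (Fin n → ℝ) := fun _ => Pi.single i 1


section helpers
open scoped ContDiff Topology
open Set

theorem aux_local_inverse {E F : Type*} [NormedAddCommGroup E] [NormedSpace ℝ E] [CompleteSpace E]
    [NormedAddCommGroup F] [NormedSpace ℝ F]
    (f : E → F) (U : Set E) (hU : IsOpen U) (hf : ContDiffOn ℝ ∞ f U) (a : E) (ha : a ∈ U)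
    (f' : E ≃L[ℝ] F) (hf' : HasFDerivAt f (f' : E →L[ℝ] F) a) :
    ∃ e : OpenPartialHomeomorph E F, a ∈ e.source ∧ e.source ⊆ U ∧ (∀ x, e x = f x) ∧
      ContDiffOn ℝ ∞ e.symm e.target ∧
      ∀ x ∈ e.source, ∃ A : E ≃L[ℝ] F, HasFDerivAt f (A : E →L[ℝ] F) x := by
  have hfa : ContDiffAt ℝ ∞ f a := hf.contDiffAt (hU.mem_nhds ha)
  have hn : (∞ : WithTop ℕ∞) ≠ 0 := by simp
  set e0 := hfa.toOpenPartialHomeomorph f hf' hn with he0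
  have hc : ContinuousOn (fderiv ℝ f) U := hf.continuousOn_fderiv_of_isOpen hU (by simp)
  set W : Set E := U ∩ fderiv ℝ f ⁻¹' (Set.range ((↑) : (E ≃L[ℝ] F) → E →L[ℝ] F)) with hW
  have hWo : IsOpen W := hc.isOpen_inter_preimage hU (ContinuousLinearEquiv.isOpen)
  have key : ∀ x ∈ W, ∃ A : E ≃L[ℝ] F, HasFDerivAt f (A : E →L[ℝ] F) x := by
    rintro x ⟨hx, A, hA⟩
    refine ⟨A, ?_⟩
    rw [hA]
    exact ((hf.contDiffAt (hU.mem_nhds hx)).differentiableAt hn).hasFDerivAt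
  refine ⟨e0.restrOpen W hWo, ?_, ?_, fun x => rfl, ?_, ?_⟩
  · refine ⟨hfa.mem_toOpenPartialHomeomorph_source hf' hn, ha, f', hf'.fderiv.symm⟩
  · rintro x ⟨_, hx⟩; exact hx.1
  · intro y hy
    have hx := (e0.restrOpen W hWo).map_target hy
    obtain ⟨A, hA⟩ := key _ hx.2
    exact ((e0.restrOpen W hWo).contDiffAt_symm hy hA
      (hf.contDiffAt (hU.mem_nhds hx.2.1))).contDiffWithinAt
  · rintro x ⟨_, hx⟩; exact key x hx

/-- pointwise application as a continuous bilinear map -/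
noncomputable def auxB (K E F : Type) [TopologicalSpace K] [CompactSpace K]
    [NormedAddCommGroup E] [NormedSpace ℝ E] [NormedAddCommGroup F] [NormedSpace ℝ F] :
    C(K, E →L[ℝ] F) →L[ℝ] (C(K, E) →L[ℝ] C(K, F)) :=
  LinearMap.mkContinuous₂
    (LinearMap.mk₂ ℝ (fun (A : C(K, E →L[ℝ] F)) (h : C(K, E)) => (⟨fun t => A t (h t), by fun_prop⟩ : C(K, F)))
      (by intros; ext; simp) (by intros; ext; simp) (by intros; ext; simp) (by intros; ext; simp))
    1 (by
      intro A h
      rw [ContinuousMap.norm_le _ (by positivity)]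
      intro t
      simp only [LinearMap.mk₂_apply, ContinuousMap.coe_mk, one_mul]
      exact (A t).le_of_opNorm_le_of_le (A.norm_coe_le_norm t) (h.norm_coe_le_norm t))

theorem auxB_apply {K E F : Type} [TopologicalSpace K] [CompactSpace K]
    [NormedAddCommGroup E] [NormedSpace ℝ E] [NormedAddCommGroup F] [NormedSpace ℝ F]
    (A : C(K, E →L[ℝ] F)) (h : C(K, E)) (t : K) : auxB K E F A h t = A t (h t) := rfl

/-- composition operator -/
def auxComp (K : Type) {E F : Type} [TopologicalSpace K] [TopologicalSpace E] [TopologicalSpace F]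
    (f : C(E, F)) : C(K, E) → C(K, F) := fun γ => f.comp γ

theorem auxComp_hasFDerivAt {K E F : Type} [TopologicalSpace K] [CompactSpace K]
    [NormedAddCommGroup E] [NormedSpace ℝ E] [NormedAddCommGroup F] [NormedSpace ℝ F]
    (f : C(E, F)) (f' : C(E, E →L[ℝ] F)) (hf : ∀ x, HasFDerivAt f (f' x) x)
    (hu : UniformContinuous f') (γ : C(K, E)) :
    HasFDerivAt (auxComp K f) (auxB K E F (auxComp K f' γ)) γ := by
  rw [hasFDerivAt_iff_isLittleO, Asymptotics.isLittleO_iff]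
  intro c hc
  obtain ⟨δ, hδ, H⟩ := Metric.uniformContinuous_iff.1 hu c hc
  filter_upwards [Metric.ball_mem_nhds γ hδ] with η hη
  rw [ContinuousMap.norm_le _ (by positivity)]
  intro t
  have h1 : dist (η t) (γ t) < δ := lt_of_le_of_lt (ContinuousMap.dist_apply_le_dist t) hη
  have h2 := (convex_ball (γ t) δ).norm_image_sub_le_of_norm_hasFDerivWithin_le'
    (f := f) (f' := f') (φ := f' (γ t)) (C := c) (x := γ t) (y := η t)
    (fun x _ => (hf x).hasFDerivWithinAt)
    (fun x hx => by
      have := H (a := x) (b := γ t) hx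
      rw [dist_eq_norm] at this
      exact this.le) (Metric.mem_ball_self hδ) h1
  refine le_trans h2 ?_
  gcongr
  exact (η - γ).norm_coe_le_norm t

theorem auxComp_contDiff_nat {K E : Type} [TopologicalSpace K] [CompactSpace K]
    [NormedAddCommGroup E] [NormedSpace ℝ E] (n : ℕ) :
    ∀ {F : Type} [NormedAddCommGroup F] [NormedSpace ℝ F]
    (f : C(E, F)), ContDiff ℝ ∞ f → HasCompactSupport f → ContDiff ℝ n (auxComp K f) := by
  induction n with
  | zero =>
    intro F _ _ f hf hs
    exact contDiff_zero.2 (f.continuous_postcomp)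
  | succ n ih =>
    intro F _ _ f hf hs
    have hf1 : ContDiff ℝ ∞ (fderiv ℝ f) := hf.fderiv_right (by simp)
    let f' : C(E, E →L[ℝ] F) := ⟨fderiv ℝ f, hf1.continuous⟩
    push_cast
    rw [contDiff_succ_iff_hasFDerivAt]
    refine ⟨fun γ => auxB K E F (auxComp K f' γ), ?_, ?_⟩
    · exact (auxB K E F).contDiff.comp (ih f' hf1 (hs.fderiv ℝ))
    · intro γ
      refine auxComp_hasFDerivAt f f' (fun x => (hf.differentiable (by simp) x).hasFDerivAt) ?_ γ
      exact (hs.fderiv ℝ).uniformContinuous_of_continuous hf1.continuous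

theorem auxComp_contDiff {K E F : Type} [TopologicalSpace K] [CompactSpace K]
    [NormedAddCommGroup E] [NormedSpace ℝ E] [NormedAddCommGroup F] [NormedSpace ℝ F]
    (f : C(E, F)) (hf : ContDiff ℝ ∞ f) (hs : HasCompactSupport f) :
    ContDiff ℝ ∞ (auxComp K f) :=
  contDiff_infty.2 fun n => auxComp_contDiff_nat n f hf hs

/-- integration operator -/
noncomputable def auxJ (E : Type) [NormedAddCommGroup E] [NormedSpace ℝ E] :
    C(Icc (0:ℝ) 1, E) →L[ℝ] C(Icc (0:ℝ) 1, E) :=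
  LinearMap.mkContinuous
    { toFun := fun γ => ⟨fun t => ∫ s in (0:ℝ)..t, IccExtend zero_le_one γ s, by
        have : Continuous (IccExtend zero_le_one γ) := γ.continuous.Icc_extend'
        exact (intervalIntegral.continuous_primitive (fun a b => this.intervalIntegrable a b) 0).comp
          continuous_subtype_val⟩
      map_add' := by
        intro γ η
        ext t
        have h1 : Continuous (IccExtend zero_le_one γ) := γ.continuous.Icc_extend'
        have h2 : Continuous (IccExtend zero_le_one η) := η.continuous.Icc_extend'
        exact intervalIntegral.integral_add (h1.intervalIntegrable _ _) (h2.intervalIntegrable _ _)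
      map_smul' := by
        intro c γ
        ext t
        exact intervalIntegral.integral_smul c _ } 1 (by
      intro γ
      rw [ContinuousMap.norm_le _ (by positivity)]
      intro t
      have h := intervalIntegral.norm_integral_le_of_norm_le_const (a := (0:ℝ)) (b := t)
        (f := IccExtend zero_le_one γ) (C := ‖γ‖) (fun x _ => γ.norm_coe_le_norm _)
      refine h.trans ?_
      rw [mul_comm, sub_zero, abs_of_nonneg t.2.1]
      gcongr
      exact t.2.2)

theorem auxJ_apply {E : Type} [NormedAddCommGroup E] [NormedSpace ℝ E]
    (γ : C(Icc (0:ℝ) 1, E)) (t : Icc (0:ℝ) 1) :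
    auxJ E γ t = ∫ s in (0:ℝ)..t, IccExtend zero_le_one γ s := rfl

theorem auxJ_deriv {E : Type} [NormedAddCommGroup E] [NormedSpace ℝ E] [CompleteSpace E]
    (a : E) (γ η : C(Icc (0:ℝ) 1, E)) (h : ∀ t, γ t = a + auxJ E η t) (t : ℝ) (ht : t ∈ Ico (0:ℝ) 1) :
    HasDerivWithinAt (IccExtend zero_le_one γ) (IccExtend zero_le_one η t) (Ici t) t := by
  have h2 : Continuous (IccExtend zero_le_one η) := η.continuous.Icc_extend'
  have h3 : HasDerivAt (fun t => a + ∫ s in (0:ℝ)..t, IccExtend zero_le_one η s)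
      (IccExtend zero_le_one η t) t := by
    exact (intervalIntegral.integral_hasDerivAt_right (h2.intervalIntegrable _ _)
      (h2.stronglyMeasurableAtFilter _ _) h2.continuousAt).const_add a
  have heq : ∀ s ∈ Icc (0:ℝ) 1, IccExtend zero_le_one γ s =
      a + ∫ s in (0:ℝ)..s, IccExtend zero_le_one η s := by
    intro s hs
    rw [IccExtend_of_mem _ _ hs, h]
    rfl
  refine h3.hasDerivWithinAt.congr_of_eventuallyEq ?_ (heq t ⟨ht.1, ht.2.le⟩)
  filter_upwards [Icc_mem_nhdsGE ht.2] with s hs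
  exact heq s ⟨ht.1.trans hs.1, hs.2⟩

end helpers

section helpers2
open scoped ContDiff Topology
open Set

theorem aux_cutoff {n : ℕ} (U : Set (Fin n → ℝ)) (hU : IsOpen U) (p : Fin n → ℝ) (hp : p ∈ U)
    (v : Fin n → (Fin n → ℝ) → (Fin n → ℝ))
    (hsmooth : ∀ i, ContDiffOn ℝ ∞ (v i) U) :
    ∃ (w : Fin n → C((Fin n → ℝ), (Fin n → ℝ))) (r : ℝ), 0 < r ∧ Metric.ball p r ⊆ U ∧
      (∀ j, ContDiff ℝ ∞ (w j)) ∧ (∀ j, HasCompactSupport (w j)) ∧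
      ∀ j, ∀ x ∈ Metric.ball p r, w j x = v j x := by
  obtain ⟨R, hR, hRU⟩ := Metric.nhds_basis_closedBall.mem_iff.1 (hU.mem_nhds hp)
  let χ : ContDiffBump p := ⟨R/2, R, by positivity, by linarith⟩
  have hsm : ∀ j, ContDiff ℝ ∞ (fun x => χ x • v j x) := by
    intro j
    rw [contDiff_iff_contDiffAt]
    intro x
    by_cases hx : x ∈ U
    · exact χ.contDiff.contDiffAt.smul ((hsmooth j).contDiffAt (hU.mem_nhds hx))
    · have hx' : x ∈ (Metric.closedBall p R)ᶜ := fun h => hx (hRU h)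
      have : (fun x => χ x • v j x) =ᶠ[𝓝 x] fun _ => 0 := by
        filter_upwards [Metric.isClosed_closedBall.isOpen_compl.mem_nhds hx'] with y hy
        have : R ≤ dist y p := by
          simp only [mem_compl_iff, Metric.mem_closedBall, not_le] at hy; exact hy.le
        simp [χ.zero_of_le_dist this]
      exact contDiffAt_const.congr_of_eventuallyEq this
  refine ⟨fun j => ⟨fun x => χ x • v j x, (hsm j).continuous⟩, R/2, by positivity, ?_, hsm, ?_, ?_⟩
  · exact (Metric.ball_subset_closedBall.trans
      (Metric.closedBall_subset_closedBall (by linarith))).trans hRU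
  · intro j
    exact χ.hasCompactSupport.smul_right
  · intro j x hx
    have : χ x = 1 := χ.one_of_mem_closedBall (Metric.ball_subset_closedBall hx)
    simp [this]

theorem aux_flow {n : ℕ} (p : Fin n → ℝ) (ℓ π : (Fin n → ℝ) →L[ℝ] (Fin n → ℝ))
    (w : Fin n → C((Fin n → ℝ), (Fin n → ℝ)))
    (hw : ∀ j, ContDiff ℝ ∞ (w j)) (hs : ∀ j, HasCompactSupport (w j)) :
    ∃ (N : Set (Fin n → ℝ)) (Γ : (Fin n → ℝ) → C(Icc (0:ℝ) 1, Fin n → ℝ)),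
      IsOpen N ∧ 0 ∈ N ∧ ContDiffOn ℝ ∞ Γ N ∧ Γ 0 = ContinuousMap.const _ p ∧
      ∀ c ∈ N, Γ c = ContinuousLinearMap.const ℝ (Icc (0:ℝ) 1) (p + ℓ c) +
        auxJ _ (∑ j, (π c) j • auxComp (Icc (0:ℝ) 1) (w j) (Γ c)) := by
  let E := Fin n → ℝ
  let S := C(Icc (0:ℝ) 1, Fin n → ℝ)
  let k : E →L[ℝ] S := ContinuousLinearMap.const ℝ (Icc (0:ℝ) 1)
  let H : E × S → E × S := fun z => (z.1, z.2 - k (p + ℓ z.1) -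
    auxJ _ (∑ j, (π z.1) j • auxComp (Icc (0:ℝ) 1) (w j) z.2))
  have hcomp : ∀ j, ContDiff ℝ ∞ (auxComp (Icc (0:ℝ) 1) (w j)) :=
    fun j => auxComp_contDiff (w j) (hw j) (hs j)
  have hcoef : ∀ j, ContDiff ℝ ∞ (fun z : E × S => (π z.1) j) := fun j =>
    (((ContinuousLinearMap.proj (R := ℝ) (φ := fun _ : Fin n => ℝ) j).comp π).comp
      (ContinuousLinearMap.fst ℝ E S)).contDiff
  have hH : ContDiff ℝ ∞ H := by
    refine contDiff_fst.prodMk ((contDiff_snd.sub ?_).sub ?_)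
    · exact k.contDiff.comp (contDiff_const.add (ℓ.contDiff.comp contDiff_fst))
    · refine (auxJ (Fin n → ℝ)).contDiff.comp (ContDiff.sum fun j _ => ?_)
      exact (hcoef j).smul ((hcomp j).comp contDiff_snd)
  let c0 : S := k p
  let D : E →L[ℝ] S := - (k.comp ℓ) - (auxJ _).comp (∑ j,
    ((ContinuousLinearMap.proj (R := ℝ) (φ := fun _ : Fin n => ℝ) j).comp π).smulRight
      (auxComp (Icc (0:ℝ) 1) (w j) c0))
  have hD : HasFDerivAt H (((ContinuousLinearEquiv.refl ℝ E).skewProd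
      (ContinuousLinearEquiv.refl ℝ S) D : (E × S) ≃L[ℝ] (E × S)) : E × S →L[ℝ] E × S) (0, c0) := by
    have h1 : HasFDerivAt (fun z : E × S => z.1) (ContinuousLinearMap.fst ℝ E S) (0, c0) :=
      hasFDerivAt_fst
    have h2 : HasFDerivAt (fun z : E × S => z.2) (ContinuousLinearMap.snd ℝ E S) (0, c0) :=
      hasFDerivAt_snd
    have h3 : HasFDerivAt (fun z : E × S => k (p + ℓ z.1))
        ((k.comp ℓ).comp (ContinuousLinearMap.fst ℝ E S)) (0, c0) :=
      k.hasFDerivAt.comp _ ((ℓ.hasFDerivAt.comp _ h1).const_add p)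
    have h4 : ∀ j, HasFDerivAt (fun z : E × S => (π z.1) j • auxComp (Icc (0:ℝ) 1) (w j) z.2)
        (((((ContinuousLinearMap.proj (R := ℝ) (φ := fun _ : Fin n => ℝ) j).comp π).smulRight
      (auxComp (Icc (0:ℝ) 1) (w j) c0))).comp (ContinuousLinearMap.fst ℝ E S)) (0, c0) := by
      intro j
      have a1 : HasFDerivAt (fun z : E × S => (π z.1) j)
        (((ContinuousLinearMap.proj (R := ℝ) (φ := fun _ : Fin n => ℝ) j).comp π).comp
          (ContinuousLinearMap.fst ℝ E S)) (0, c0) :=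
        (((ContinuousLinearMap.proj (R := ℝ) (φ := fun _ : Fin n => ℝ) j).comp π).comp
          (ContinuousLinearMap.fst ℝ E S)).hasFDerivAt
      have a2 := a1.fun_smul ((((hcomp j).differentiable (by simp)).differentiableAt (x := c0)).hasFDerivAt.comp
        ((0 : E), c0) h2)
      convert! a2 using 1
      ext z <;> simp
    have h5 := (auxJ (Fin n → ℝ)).hasFDerivAt.comp _ (HasFDerivAt.fun_sum (u := Finset.univ) fun j _ => h4 j)
    have h6 := h1.prodMk ((h2.sub h3).sub h5)
    convert! h6 using 1
    refine ContinuousLinearMap.ext fun z => ?_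
    refine Prod.ext ?_ ?_
    · simp
    · simp only [D, ContinuousLinearEquiv.coe_coe, ContinuousLinearEquiv.skewProd_apply]
      simp [sub_eq_add_neg, add_assoc]
  obtain ⟨e, he0, -, hef, hes, -⟩ := aux_local_inverse H univ isOpen_univ hH.contDiffOn (0, c0)
    (mem_univ _) _ hD
  have hH0 : H (0, c0) = (0, 0) := by
    simp [H, c0]
  let ι : E → E × S := fun c => (c, 0)
  have hι : ContDiff ℝ ∞ ι := contDiff_id.prodMk contDiff_const
  refine ⟨ι ⁻¹' e.target, fun c => (e.symm (ι c)).2, e.open_target.preimage hι.continuous, ?_, ?_, ?_, ?_⟩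
  · have := e.map_source he0
    rwa [hef, hH0] at this
  · exact contDiff_snd.comp_contDiffOn (hes.comp hι.contDiffOn (fun x hx => hx))
  · have := e.left_inv he0
    rw [hef, hH0] at this
    change (e.symm (0,0)).2 = _
    rw [this]
    rfl
  · intro c hc
    have h1 := e.right_inv hc
    rw [hef] at h1
    have h2 : (e.symm (ι c)).1 = c := congrArg Prod.fst h1
    have h3 := congrArg Prod.snd h1
    simp only [H, ι] at h3
    change (e.symm (ι c)).2 = _
    change (e.symm (ι c)).2 - k (p + ℓ (e.symm (ι c)).1) -
      auxJ _ (∑ j, (π (e.symm (ι c)).1) j • auxComp (Icc (0:ℝ) 1) (w j) (e.symm (ι c)).2) = 0 at h3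
    rw [h2, sub_sub, sub_eq_zero] at h3
    exact h3

theorem aux_flow_deriv {n : ℕ} (p : Fin n → ℝ) (ℓ π : (Fin n → ℝ) →L[ℝ] (Fin n → ℝ))
    (w : Fin n → C((Fin n → ℝ), (Fin n → ℝ)))
    (hw : ∀ j, ContDiff ℝ ∞ (w j)) (hs : ∀ j, HasCompactSupport (w j))
    (N : Set (Fin n → ℝ)) (Γ : (Fin n → ℝ) → C(Icc (0:ℝ) 1, Fin n → ℝ))
    (hN : IsOpen N) (hΓ : ContDiffOn ℝ ∞ Γ N)
    (hode : ∀ c ∈ N, Γ c = ContinuousLinearMap.const ℝ (Icc (0:ℝ) 1) (p + ℓ c) +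
        auxJ _ (∑ j, (π c) j • auxComp (Icc (0:ℝ) 1) (w j) (Γ c)))
    (c : Fin n → ℝ) (hc : c ∈ N) (h : Fin n → ℝ) :
    ∃ b : C(Icc (0:ℝ) 1, Fin n → ℝ),
      (∀ t, fderiv ℝ Γ c h t = ℓ h + auxJ _ b t) ∧
      ∀ t, b t = ∑ j, (π h) j • w j (Γ c t) +
        ∑ j, (π c) j • fderiv ℝ (w j) (Γ c t) (fderiv ℝ Γ c h t) := by
  have hd : HasFDerivAt Γ (fderiv ℝ Γ c) c :=
    ((hΓ.contDiffAt (hN.mem_nhds hc)).differentiableAt (by simp)).hasFDerivAt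
  let E := Fin n → ℝ
  let S := C(Icc (0:ℝ) 1, Fin n → ℝ)
  let k : E →L[ℝ] S := ContinuousLinearMap.const ℝ (Icc (0:ℝ) 1)
  let w' : Fin n → C(E, E →L[ℝ] E) := fun j =>
    ⟨fderiv ℝ (w j), (hw j).continuous_fderiv (by simp)⟩
  have hcomp : ∀ j, HasFDerivAt (auxComp (Icc (0:ℝ) 1) (w j))
      (auxB _ _ _ (auxComp _ (w' j) (Γ c))) (Γ c) := fun j =>
    auxComp_hasFDerivAt (w j) (w' j) (fun x => ((hw j).differentiable (by simp) x).hasFDerivAt)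
      (((hs j).fderiv ℝ).uniformContinuous_of_continuous ((hw j).continuous_fderiv (by simp))) _
  have h3 : HasFDerivAt (fun z : E => k (p + ℓ z)) (k.comp ℓ) c :=
      k.hasFDerivAt.comp _ (ℓ.hasFDerivAt.const_add p)
  have h4 := fun j => (((ContinuousLinearMap.proj (R := ℝ) (φ := fun _ : Fin n => ℝ) j).comp π).hasFDerivAt
    (x := c)).fun_smul ((hcomp j).comp c hd)
  have h5 := h3.add ((auxJ (Fin n → ℝ)).hasFDerivAt.comp _
    (HasFDerivAt.fun_sum (u := Finset.univ) fun j _ => h4 j))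
  have h6 := h5.congr_of_eventuallyEq (f₁ := Γ)
    (by filter_upwards [hN.mem_nhds hc] with z hz using hode z hz)
  have h7 := hd.unique h6
  have h8 := congrArg (fun L : E →L[ℝ] S => L h) h7
  let b : S := ∑ j, ((π c) j • auxB _ _ _ (auxComp _ (w' j) (Γ c)) (fderiv ℝ Γ c h) +
    (π h) j • auxComp _ (w j) (Γ c))
  have h9 : fderiv ℝ Γ c h = k (ℓ h) + auxJ _ b := by
    refine h8.trans ?_
    simp only [_root_.add_apply, ContinuousLinearMap.comp_apply, _root_.sum_apply]
    rfl
  refine ⟨b, fun t => ?_, fun t => ?_⟩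
  · exact congrArg (fun g : S => g t) h9
  · refine (ContinuousMap.sum_apply _ _ _).trans ?_
    rw [← Finset.sum_add_distrib]
    exact Finset.sum_congr rfl fun j _ => add_comm _ _

end helpers2

section helpers3
open scoped ContDiff Topology
open Set

theorem aux_equiv {n : ℕ} (a : Fin n → Fin n → ℝ) (ha : LinearIndependent ℝ a) :
    ∃ A : (Fin n → ℝ) ≃L[ℝ] (Fin n → ℝ), ∀ c, A c = ∑ j, c j • a j := by
  let b := basisOfLinearIndependentOfCardEqFinrank' a ha (by simp)
  refine ⟨b.equivFun.symm.toContinuousLinearEquiv, fun c => ?_⟩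
  simp [Module.Basis.equivFun_symm_apply, b]

theorem aux_coframe {n : ℕ} (U : Set (Fin n → ℝ)) (hU : IsOpen U)
    (v : Fin n → (Fin n → ℝ) → (Fin n → ℝ))
    (hsmooth : ∀ i, ContDiffOn ℝ ∞ (v i) U)
    (hind : ∀ x ∈ U, LinearIndependent ℝ (fun i => v i x)) (i : Fin n) :
    ∃ θ : (Fin n → ℝ) → ((Fin n → ℝ) →L[ℝ] ℝ), ContDiffOn ℝ ∞ θ U ∧
      ∀ x ∈ U, ∀ j, θ x (v j x) = if j = i then 1 else 0 := by
  let E := Fin n → ℝ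
  let m : E → (E →L[ℝ] E) := fun x => ∑ j,
    (ContinuousLinearMap.proj (R := ℝ) (φ := fun _ : Fin n => ℝ) j).smulRight (v j x)
  have hm : ContDiffOn ℝ ∞ m U := by
    refine ContDiffOn.sum fun j _ => ?_
    exact (ContinuousLinearMap.smulRightL ℝ E E
      (ContinuousLinearMap.proj (R := ℝ) (φ := fun _ : Fin n => ℝ) j)).contDiff.comp_contDiffOn
        (hsmooth j)
  have hmA : ∀ x ∈ U, ∃ A : E ≃L[ℝ] E, (A : E →L[ℝ] E) = m x ∧ ∀ j, A (Pi.single j 1) = v j x := by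
    intro x hx
    obtain ⟨A, hA⟩ := aux_equiv _ (hind x hx)
    refine ⟨A, ?_, ?_⟩
    · refine ContinuousLinearMap.ext fun c => ?_
      refine (hA c).trans ?_
      simp [m]
      rfl
    · intro j
      rw [hA]
      simp [Pi.single_apply]
  refine ⟨fun x => (ContinuousLinearMap.proj (R := ℝ) (φ := fun _ : Fin n => ℝ) i).comp
    (ContinuousLinearMap.inverse (m x)), ?_, ?_⟩
  · have : ContDiffOn ℝ ∞ (fun x => ContinuousLinearMap.inverse (m x)) U := by
      intro x hx
      obtain ⟨A, hA, -⟩ := hmA x hx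
      have h1 := contDiffAt_map_inverse (𝕜 := ℝ) (n := ∞) A
      rw [hA] at h1
      exact h1.comp_contDiffWithinAt x (hm x hx)
    exact contDiffOn_const.clm_comp this
  · intro x hx j
    obtain ⟨A, hA, hA2⟩ := hmA x hx
    simp only [← hA, ContinuousLinearMap.inverse_equiv, ContinuousLinearMap.comp_apply, ← hA2 j]
    simp [Pi.single_apply, eq_comm]

theorem aux_alg {n : ℕ} (U : Set (Fin n → ℝ)) (hU : IsOpen U)
    (v : Fin n → (Fin n → ℝ) → (Fin n → ℝ))
    (hsmooth : ∀ i, ContDiffOn ℝ ∞ (v i) U)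
    (hind : ∀ x ∈ U, LinearIndependent ℝ (fun i => v i x))
    (hbr : ∀ i j, ∀ x ∈ U,
      vbracket (v i) (v j) x ∈ Submodule.span ℝ {v i x, v j x}) (i : Fin n)
    (θ : (Fin n → ℝ) → ((Fin n → ℝ) →L[ℝ] ℝ)) (hθ : ContDiffOn ℝ ∞ θ U)
    (hθv : ∀ x ∈ U, ∀ j, θ x (v j x) = if j = i then 1 else 0)
    (x : Fin n → ℝ) (hx : x ∈ U) (j : Fin n) (hj : j ≠ i) (y : Fin n → ℝ) :
    fderiv ℝ θ x (v j x) y + θ x (fderiv ℝ (v j) x y) =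
      - θ x (vbracket (v j) (v i) x) * θ x y := by
  have hdθ : HasFDerivAt θ (fderiv ℝ θ x) x :=
    ((hθ.contDiffAt (hU.mem_nhds hx)).differentiableAt (by simp)).hasFDerivAt
  have hdv : ∀ k, HasFDerivAt (v k) (fderiv ℝ (v k) x) x := fun k =>
    (((hsmooth k).contDiffAt (hU.mem_nhds hx)).differentiableAt (by simp)).hasFDerivAt
  have key : ∀ k u, fderiv ℝ θ x u (v k x) = - θ x (fderiv ℝ (v k) x u) := by
    intro k u
    have h1 := hdθ.clm_apply (hdv k)
    have h2 : HasFDerivAt (fun z => θ z (v k z)) (0 : (Fin n → ℝ) →L[ℝ] ℝ) x := by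
      refine (hasFDerivAt_const (if k = i then (1:ℝ) else 0) x).congr_of_eventuallyEq ?_
      filter_upwards [hU.mem_nhds hx] with z hz using hθv z hz k
    have h3 := congrArg (fun L : (Fin n → ℝ) →L[ℝ] ℝ => L u) (h1.unique h2)
    simp at h3
    linarith
  obtain ⟨A, hA⟩ := aux_equiv _ (hind x hx)
  have hbasis : ∀ k, fderiv ℝ θ x (v j x) (v k x) + θ x (fderiv ℝ (v j) x (v k x)) =
      - θ x (vbracket (v j) (v i) x) * θ x (v k x) := by
    intro k
    rw [key]
    have h0 : - θ x (fderiv ℝ (v k) x (v j x)) + θ x (fderiv ℝ (v j) x (v k x)) =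
        - θ x (vbracket (v j) (v k) x) := by
      simp [vbracket]
      ring
    rw [h0, hθv x hx]
    split_ifs with hk
    · rw [hk]; ring
    · obtain ⟨a, b, hab⟩ := Submodule.mem_span_pair.1 (hbr j k x hx)
      rw [← hab]
      simp [hθv x hx, hj, hk]
  have hy : y = ∑ k, (A.symm y) k • v k x := by
    rw [← hA]; simp
  rw [hy]
  simp only [map_sum, map_smul, ← Finset.sum_add_distrib, Finset.mul_sum]
  refine Finset.sum_congr rfl fun k _ => ?_
  rw [← smul_add, hbasis]
  simp only [smul_eq_mul]
  ring

theorem aux_tangent {n : ℕ} (U : Set (Fin n → ℝ)) (hU : IsOpen U)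
    (v : Fin n → (Fin n → ℝ) → (Fin n → ℝ))
    (hsmooth : ∀ i, ContDiffOn ℝ ∞ (v i) U)
    (hind : ∀ x ∈ U, LinearIndependent ℝ (fun i => v i x))
    (hbr : ∀ i j, ∀ x ∈ U,
      vbracket (v i) (v j) x ∈ Submodule.span ℝ {v i x, v j x}) (i : Fin n)
    (θ : (Fin n → ℝ) → ((Fin n → ℝ) →L[ℝ] ℝ)) (hθ : ContDiffOn ℝ ∞ θ U)
    (hθv : ∀ x ∈ U, ∀ j, θ x (v j x) = if j = i then 1 else 0)
    (γ η bγ bη : C(Icc (0:ℝ) 1, Fin n → ℝ)) (hγU : ∀ t, γ t ∈ U) (c h : Fin n → ℝ)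
    (hc : c i = 0) (hh : h i = 0) (a : Fin n → ℝ)
    (hγ : ∀ t, γ t = a + auxJ _ bγ t) (hbγ : ∀ t, bγ t = ∑ j, c j • v j (γ t))
    (hη : ∀ t, η t = 0 + auxJ _ bη t)
    (hbη : ∀ t, bη t = ∑ j, h j • v j (γ t) + ∑ j, c j • fderiv ℝ (v j) (γ t) (η t)) (t : Icc (0:ℝ) 1) :
    θ (γ t) (η t) = 0 := by
  let γ' : ℝ → (Fin n → ℝ) := IccExtend zero_le_one γ
  let η' : ℝ → (Fin n → ℝ) := IccExtend zero_le_one η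
  have hγ'U : ∀ t, γ' t ∈ U := fun t => hγU _
  have hγ'c : Continuous γ' := γ.continuous.Icc_extend'
  have hη'c : Continuous η' := η.continuous.Icc_extend'
  have hθc : ∀ t, ContinuousAt θ (γ' t) := fun t => hθ.continuousOn.continuousAt (hU.mem_nhds (hγ'U t))
  have hθγ : Continuous (fun t => θ (γ' t)) := hθ.continuousOn.comp_continuous hγ'c hγ'U
  let κ : ℝ → ℝ := fun t => ∑ j, c j * θ (γ' t) (vbracket (v j) (v i) (γ' t))
  have hκ : Continuous κ := by
    refine continuous_finsetSum _ fun j _ => continuous_const.mul (hθγ.clm_apply ?_)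
    have hd : ∀ k, Continuous (fun t => fderiv ℝ (v k) (γ' t)) := fun k =>
      ((hsmooth k).continuousOn_fderiv_of_isOpen hU (by simp)).comp_continuous hγ'c hγ'U
    have hv : ∀ k, Continuous (fun t => v k (γ' t)) := fun k =>
      (hsmooth k).continuousOn.comp_continuous hγ'c hγ'U
    exact ((hd i).clm_apply (hv j)).sub ((hd j).clm_apply (hv i))
  obtain ⟨C, hC⟩ := isCompact_Icc.exists_bound_of_continuousOn (s := Icc (0:ℝ) 1) hκ.continuousOn
  have main := eq_zero_of_abs_deriv_le_mul_abs_self_of_eq_zero_right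
    (f := fun t => θ (γ' t) (η' t)) (f' := fun t => - κ t * θ (γ' t) (η' t)) (K := C) (a := 0) (b := 1)
    (hθγ.clm_apply hη'c).continuousOn ?_ ?_ ?_ t t.2
  · simpa [γ', η'] using main
  · intro s hs
    have h1 := auxJ_deriv a γ bγ hγ s hs
    have h2 := auxJ_deriv 0 η bη hη s hs
    have hdθ : HasFDerivAt θ (fderiv ℝ θ (γ' s)) (γ' s) :=
      ((hθ.contDiffAt (hU.mem_nhds (hγ'U s))).differentiableAt (by simp)).hasFDerivAt
    have h3 := (hdθ.comp_hasDerivWithinAt s h1).clm_apply h2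
    convert! h3 using 1
    have e1 : IccExtend zero_le_one bγ s = ∑ j, c j • v j (γ' s) := hbγ _
    have e2 : IccExtend zero_le_one bη s = ∑ j, h j • v j (γ' s) +
      ∑ j, c j • fderiv ℝ (v j) (γ' s) (η' s) := hbη _
    rw [e1, e2]
    have e3 : θ (γ' s) (∑ j, h j • v j (γ' s)) = 0 := by
      simp [hθv _ (hγ'U s), hh]
    simp only [Function.comp_apply, map_add]
    rw [e3, zero_add]
    simp only [κ, map_sum, map_smul, _root_.sum_apply, _root_.smul_apply, smul_eq_mul]
    rw [← Finset.sum_neg_distrib, Finset.sum_mul, ← Finset.sum_add_distrib]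
    refine Finset.sum_congr rfl fun j _ => ?_
    by_cases hj : j = i
    · rw [hj, hc]; simp
    · have := aux_alg U hU v hsmooth hind hbr i θ hθ hθv (γ' s) (hγ'U s) j hj (η' s)
      change _ = c j * fderiv ℝ θ (γ' s) (v j (γ' s)) (η' s) + _
      rw [← mul_add, this]; ring
  · have : η 0 = 0 := by
      rw [hη, auxJ_apply]; simp
    simp [η', this]
  · intro s hs
    rw [norm_mul, norm_neg]
    gcongr
    exact hC s ⟨hs.1, hs.2.le⟩

end helpers3

section helpers4
open scoped ContDiff Topology
open Set

theorem aux_first_integral {n : ℕ} (U : Set (Fin n → ℝ)) (hU : IsOpen U) (p : Fin n → ℝ) (hp : p ∈ U)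
    (v : Fin n → (Fin n → ℝ) → (Fin n → ℝ))
    (hsmooth : ∀ i, ContDiffOn ℝ ∞ (v i) U)
    (hind : ∀ x ∈ U, LinearIndependent ℝ (fun i => v i x))
    (hbr : ∀ i j, ∀ x ∈ U,
      vbracket (v i) (v j) x ∈ Submodule.span ℝ {v i x, v j x}) (i : Fin n) :
    ∃ (W : Set (Fin n → ℝ)) (y : (Fin n → ℝ) → ℝ), IsOpen W ∧ p ∈ W ∧ W ⊆ U ∧
      ContDiffOn ℝ ∞ y W ∧ (∀ x ∈ W, ∀ j, j ≠ i → fderiv ℝ y x (v j x) = 0) ∧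
      (∀ x ∈ W, fderiv ℝ y x (v i x) ≠ 0) := by
  obtain ⟨w, r, hr, hrU, hw, hs, hwv⟩ := aux_cutoff U hU p hp v hsmooth
  let E := Fin n → ℝ
  let pr : E →L[ℝ] ℝ := ContinuousLinearMap.proj (R := ℝ) (φ := fun _ : Fin n => ℝ) i
  let ℓ : E →L[ℝ] E := pr.smulRight (v i p)
  let π : E →L[ℝ] E := ContinuousLinearMap.id ℝ E - pr.smulRight (Pi.single i 1)
  have hℓ : ∀ c, ℓ c = c i • v i p := fun c => rfl
  have hπ : ∀ c j, (π c) j = if j = i then 0 else c j := by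
    intro c j
    change c j - c i * (Pi.single i 1 : E) j = _
    by_cases hj : j = i
    · subst hj; simp
    · simp [hj]
  obtain ⟨θ, hθ, hθv⟩ := aux_coframe U hU v hsmooth hind i
  obtain ⟨N, Γ, hN, hN0, hΓ, hΓ0, hode⟩ := aux_flow p ℓ π w hw hs
  have hder := aux_flow_deriv p ℓ π w hw hs N Γ hN hΓ hode
  let ev : C(Icc (0:ℝ) 1, Fin n → ℝ) →L[ℝ] E := ContinuousMap.evalCLM ℝ (1 : Icc (0:ℝ) 1)
  let N1 : Set E := N ∩ Γ ⁻¹' (Metric.ball (ContinuousMap.const _ p) r)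
  have hN1 : IsOpen N1 := hΓ.continuousOn.isOpen_inter_preimage hN Metric.isOpen_ball
  have hN10 : (0 : E) ∈ N1 := ⟨hN0, by simp [hΓ0, hr]⟩
  have hball : ∀ c ∈ N1, ∀ t, Γ c t ∈ Metric.ball p r := fun c hc t =>
    lt_of_le_of_lt (ContinuousMap.dist_apply_le_dist (f := Γ c) (g := ContinuousMap.const _ p) t) hc.2
  let G : E → E := fun c => ev (Γ c)
  have hG : ContDiffOn ℝ ∞ G N1 := ev.contDiff.comp_contDiffOn (hΓ.mono inter_subset_left)
  have hGd : ∀ c ∈ N1, HasFDerivAt G (ev.comp (fderiv ℝ Γ c)) c := fun c hc =>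
    ev.hasFDerivAt.comp c
      ((hΓ.contDiffAt (hN.mem_nhds hc.1)).differentiableAt (by simp)).hasFDerivAt
  have hG0 : G 0 = p := by simp [G, hΓ0, ev]
  obtain ⟨A0, hA0⟩ := aux_equiv _ (hind p hp)
  have hGA : HasFDerivAt G (A0 : E →L[ℝ] E) 0 := by
    have h0 := hGd 0 hN10
    convert! h0 using 1
    refine ContinuousLinearMap.ext fun h => ?_
    obtain ⟨b, hb1, hb2⟩ := hder 0 hN0 h
    have hb : b = ContinuousMap.const _ (∑ j, (π h) j • v j p) := by
      ext1 t
      rw [hb2 t, hΓ0]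
      simp [hwv _ p (Metric.mem_ball_self hr)]
    have e1 : (ev.comp (fderiv ℝ Γ 0)) h = ℓ h + ∑ j, (π h) j • v j p := by
      refine (hb1 1).trans ?_
      rw [auxJ_apply, hb]
      simp [IccExtend, Function.comp_def]
    rw [e1]
    refine (hA0 h).trans ?_
    rw [hℓ, ← Finset.add_sum_erase _ _ (Finset.mem_univ i),
      ← Finset.add_sum_erase Finset.univ (fun j => (π h) j • v j p) (Finset.mem_univ i)]
    simp only [hπ, if_true, zero_smul, zero_add]
    congr 1
    refine Finset.sum_congr rfl fun j hj => ?_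
    rw [if_neg (Finset.ne_of_mem_erase hj)]
  obtain ⟨e, he0, heN, heG, hes, heA⟩ := aux_local_inverse G N1 hN1 hG 0 hN10 A0 hGA
  have hsub : e.target ⊆ U := by
    intro x hx
    have h1 := e.map_target hx
    have h2 := e.right_inv hx
    rw [heG] at h2
    rw [← h2]
    exact hrU (hball _ (heN h1) 1)
  have tang : ∀ c ∈ N1, ∀ h : E, h i = 0 → θ (G c) (fderiv ℝ Γ c h 1) = 0 := by
    intro c hc h hh
    obtain ⟨b, hb1, hb2⟩ := hder c hc.1 h
    have hπh : π h = h := by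
      funext j
      rw [hπ]
      split_ifs with hj
      · rw [hj, hh]
      · rfl
    have hfd : ∀ j t, fderiv ℝ (w j) (Γ c t) = fderiv ℝ (v j) (Γ c t) := by
      intro j t
      refine Filter.EventuallyEq.fderiv_eq ?_
      filter_upwards [Metric.isOpen_ball.mem_nhds (hball c hc t)] with z hz using hwv j z hz
    refine aux_tangent U hU v hsmooth hind hbr i θ hθ hθv (Γ c) (fderiv ℝ Γ c h)
      (∑ j, (π c) j • auxComp (Icc (0:ℝ) 1) (w j) (Γ c)) b (fun t => hrU (hball c hc t))
      (π c) h (by simp [hπ]) hh (p + ℓ c) ?_ ?_ ?_ ?_ 1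
    · intro t
      exact congrArg (fun g : C(Icc (0:ℝ) 1, Fin n → ℝ) => g t) (hode c hc.1)
    · intro t
      rw [ContinuousMap.sum_apply]
      refine Finset.sum_congr rfl fun j _ => ?_
      rw [← hwv j _ (hball c hc t)]
      rfl
    · intro t
      rw [hb1, hℓ, hh, zero_smul]
    · intro t
      rw [hb2, hπh]
      simp only [hfd, hwv _ _ (hball c hc t)]
  have key : ∀ x ∈ e.target, ∃ lam : ℝ, ∀ u,
      θ x u = lam * fderiv ℝ (fun x => e.symm x i) x u := by
    intro x hx
    have hcs := e.map_target hx
    obtain ⟨A, hA⟩ := heA _ hcs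
    have hc := heN hcs
    have hx' : G (e.symm x) = x := by
      have := e.right_inv hx
      rwa [heG] at this
    have hAeq : ∀ h, A h = fderiv ℝ Γ (e.symm x) h 1 := fun h =>
      congrArg (fun L : E →L[ℝ] E => L h) (hA.unique (hGd _ hc))
    have hA' : HasFDerivAt e (A : E →L[ℝ] E) (e.symm x) := 
      hA.congr_of_eventuallyEq (Filter.Eventually.of_forall heG)
    have h1 := e.hasFDerivAt_symm hx hA'
    have h2 : HasFDerivAt (fun x => e.symm x i) (pr.comp (A.symm : E →L[ℝ] E)) x :=
      pr.hasFDerivAt.comp x h1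
    refine ⟨θ x (A (Pi.single i 1)), fun u => ?_⟩
    rw [h2.fderiv]
    change _ = _ * (A.symm u) i
    have h3 := tang _ hc (A.symm u - (A.symm u) i • (Pi.single i 1 : E)) (by
      change (A.symm u) i - (A.symm u) i * (Pi.single i 1 : E) i = 0
      simp)
    rw [← hAeq, hx'] at h3
    simp only [map_sub, map_smul, ContinuousLinearEquiv.apply_symm_apply, smul_eq_mul] at h3
    linarith
  refine ⟨e.target, fun x => e.symm x i, e.open_target, ?_, hsub, ?_, ?_, ?_⟩
  · have := e.map_source he0
    rwa [heG, hG0] at this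
  · exact pr.contDiff.comp_contDiffOn hes
  · intro x hx j hj
    obtain ⟨lam, hl⟩ := key x hx
    have h1 := hl (v i x)
    rw [hθv x (hsub hx), if_pos rfl] at h1
    have h2 := hl (v j x)
    rw [hθv x (hsub hx), if_neg hj] at h2
    have : lam ≠ 0 := by rintro rfl; simp at h1
    simpa [this] using h2.symm
  · intro x hx h0
    obtain ⟨lam, hl⟩ := key x hx
    have h1 := hl (v i x)
    rw [hθv x (hsub hx), if_pos rfl, h0] at h1
    simp at h1

end helpers4

theorem stmt13 {n : ℕ} (U : Set (Fin n → ℝ)) (hU : IsOpen U) (p : Fin n → ℝ) (hp : p ∈ U)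
    (v : Fin n → (Fin n → ℝ) → (Fin n → ℝ))
    (hsmooth : ∀ i, ContDiffOn ℝ (⊤ : ℕ∞) (v i) U)
    (hind : ∀ x ∈ U, LinearIndependent ℝ (fun i => v i x))
    (hbr : ∀ i j, ∀ x ∈ U,
      vbracket (v i) (v j) x ∈ Submodule.span ℝ {v i x, v j x}) :
    ∃ (V : Set (Fin n → ℝ)) (Φ : (Fin n → ℝ) → (Fin n → ℝ))
      (f : Fin n → (Fin n → ℝ) → ℝ),
      IsOpen V ∧ p ∈ V ∧ V ⊆ U ∧
      ContDiffOn ℝ (⊤ : ℕ∞) Φ V ∧ Set.InjOn Φ V ∧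
      (∀ x ∈ V, Function.Bijective (fderiv ℝ Φ x)) ∧
      (∀ i, ContDiffOn ℝ (⊤ : ℕ∞) (f i) V) ∧
      (∀ i, ∀ x ∈ V, f i x ≠ 0) ∧
      (∀ i, ∀ x ∈ V, fderiv ℝ Φ x (v i x) = f i x • (Pi.single i 1 : Fin n → ℝ)) := by
  choose W y hWo hpW hWU hy hy0 hy1 using
    fun i => aux_first_integral U hU p hp v hsmooth hind hbr i
  let V0 : Set (Fin n → ℝ) := U ∩ ⋂ i, W i
  have hV0 : IsOpen V0 := hU.inter (isOpen_iInter_of_finite hWo)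
  have hpV0 : p ∈ V0 := ⟨hp, Set.mem_iInter.2 hpW⟩
  have hVW : ∀ i, V0 ⊆ W i := fun i x hx => Set.mem_iInter.1 hx.2 i
  let Φ : (Fin n → ℝ) → (Fin n → ℝ) := fun x i => y i x
  have hΦ : ContDiffOn ℝ (⊤ : ℕ∞) Φ V0 := contDiffOn_pi.2 fun i => (hy i).mono (hVW i)
  have hyd : ∀ i, ∀ x ∈ V0, DifferentiableAt ℝ (y i) x := fun i x hx =>
    ((hy i).contDiffAt ((hWo i).mem_nhds (hVW i hx))).differentiableAt (by simp)
  have hΦd : ∀ x ∈ V0, HasFDerivAt Φ (ContinuousLinearMap.pi fun i => fderiv ℝ (y i) x) x :=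
    fun x hx => hasFDerivAt_pi.2 fun i => (hyd i x hx).hasFDerivAt
  have hdiag : ∀ i, ∀ x ∈ V0, fderiv ℝ Φ x (v i x) =
      (fderiv ℝ (y i) x (v i x)) • (Pi.single i 1 : Fin n → ℝ) := by
    intro i x hx
    rw [(hΦd x hx).fderiv]
    funext k
    rw [ContinuousLinearMap.pi_apply]
    by_cases hk : k = i
    · subst hk; simp
    · rw [hy0 k x (hVW k hx) i (Ne.symm hk)]
      simp [hk]
  have hsurj : ∀ x ∈ V0, Function.Surjective (fderiv ℝ Φ x) := by
    intro x hx u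
    refine ⟨∑ j, (u j / fderiv ℝ (y j) x (v j x)) • v j x, ?_⟩
    simp only [map_sum, map_smul, hdiag _ x hx, smul_smul]
    funext k
    simp [Pi.single_apply, div_mul_cancel₀ _ (hy1 k x (hVW k hx))]
  have hbij : ∀ x ∈ V0, Function.Bijective (fderiv ℝ Φ x) := fun x hx =>
    ⟨(LinearMap.injective_iff_surjective (f := (fderiv ℝ Φ x).toLinearMap)).2 (hsurj x hx),
      hsurj x hx⟩
  let A : (Fin n → ℝ) ≃L[ℝ] (Fin n → ℝ) := ContinuousLinearEquiv.ofBijective (fderiv ℝ Φ p)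
    (LinearMap.ker_eq_bot.2 (hbij p hpV0).1) (LinearMap.range_eq_top.2 (hbij p hpV0).2)
  have hA : HasFDerivAt Φ (A : (Fin n → ℝ) →L[ℝ] (Fin n → ℝ)) p := by
    have h1 : (A : (Fin n → ℝ) →L[ℝ] (Fin n → ℝ)) = fderiv ℝ Φ p :=
      ContinuousLinearEquiv.coe_ofBijective _ _ _
    rw [h1]
    exact (hΦd p hpV0).differentiableAt.hasFDerivAt
  obtain ⟨e, hpe, heV, heΦ, -, -⟩ := aux_local_inverse Φ V0 hV0 hΦ p hpV0 A hA
  refine ⟨e.source, Φ, fun i x => fderiv ℝ (y i) x (v i x), e.open_source, hpe,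
    fun x hx => (heV hx).1, hΦ.mono heV, ?_, fun x hx => hbij x (heV hx), ?_,
    fun i x hx => hy1 i x (hVW i (heV hx)), fun i x hx => hdiag i x (heV hx)⟩
  · intro a ha b hb hab
    exact e.injOn ha hb (by rw [heΦ, heΦ]; exact hab)
  · intro i
    have h1 : ContDiffOn ℝ (⊤ : ℕ∞) (fderiv ℝ (y i)) (W i) :=
      (hy i).fderiv_of_isOpen (hWo i) (by simp)
    exact (h1.mono (heV.trans (hVW i))).clm_apply
      ((hsmooth i).mono (fun x hx => (heV hx).1))
end

section
/- Let n = 2 and let L be a smooth operator field on an open subset of ℝ² having two distinct real eigenvalues at every point. Then near every point there exist local coordinates in which L is diagonal. -/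
open Matrix

section Aux16
open Set Filter Topology Metric

/-- Pointwise application of a bilinear map, on spaces of continuous maps. -/
noncomputable def aux16Bil (K : Type) [TopologicalSpace K] [CompactSpace K]
    {H E F : Type} [NormedAddCommGroup H] [NormedSpace ℝ H] [NormedAddCommGroup E]
    [NormedSpace ℝ E] [NormedAddCommGroup F] [NormedSpace ℝ F] (B : H →L[ℝ] E →L[ℝ] F) :
    C(K, H) →L[ℝ] C(K, E) →L[ℝ] C(K, F) :=
  LinearMap.mkContinuous₂
    (LinearMap.mk₂ ℝ (fun (A : C(K, H)) (b : C(K, E)) =>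
      (⟨fun t => B (A t) (b t), (B.continuous.comp A.continuous).clm_apply b.continuous⟩ :
        C(K, F)))
      (by intros; ext; simp) (by intros; ext; simp)
      (by intros; ext; simp) (by intros; ext; simp)) ‖B‖
    (by
      intro A b
      rw [ContinuousMap.norm_le _ (by positivity)]
      intro t
      simp only [LinearMap.mk₂_apply, ContinuousMap.coe_mk]
      refine (B.le_opNorm₂ _ _).trans ?_
      gcongr
      · exact A.norm_coe_le_norm t
      · exact b.norm_coe_le_norm t)

theorem aux16Bil_contDiff (K : Type) [TopologicalSpace K] [CompactSpace K]
    {H E F : Type} [NormedAddCommGroup H] [NormedSpace ℝ H] [NormedAddCommGroup E]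
    [NormedSpace ℝ E] [NormedAddCommGroup F] [NormedSpace ℝ F] (B : H →L[ℝ] E →L[ℝ] F)
    (n : WithTop ℕ∞) : ContDiff ℝ n (aux16Bil K B) := ContinuousLinearMap.contDiff _

/-- Superposition operator. -/
def aux16N (K : Type) [TopologicalSpace K] {E F : Type} [TopologicalSpace E] [TopologicalSpace F]
    (g : C(E, F)) : C(K, E) → C(K, F) := fun a => g.comp a

theorem aux16N_cont (K : Type) [TopologicalSpace K] [CompactSpace K]
    {E F : Type} [NormedAddCommGroup E] [NormedAddCommGroup F] (g : C(E, F)) (a : C(K, E))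
    (c : ℝ) (hc : 0 < c) : ∃ δ > 0, ∀ {b : C(K, E)}, dist b a < δ →
      dist (aux16N K g b) (aux16N K g a) < c := by
  have hcont : Continuous (aux16N K g : C(K, E) → C(K, F)) :=
    ContinuousMap.continuous_postcomp g
  exact Metric.continuousAt_iff.1 (hcont.continuousAt (x := a)) c hc

theorem aux16N_hasFDerivAt (K : Type) [TopologicalSpace K] [CompactSpace K]
    {E F : Type} [NormedAddCommGroup E] [NormedSpace ℝ E]
    [NormedAddCommGroup F] [NormedSpace ℝ F] (g : C(E, F)) (g' : C(E, E →L[ℝ] F))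
    (h : ∀ x, HasFDerivAt g (g' x) x) (a : C(K, E)) :
    HasFDerivAt (aux16N K g) (aux16Bil K (ContinuousLinearMap.id ℝ (E →L[ℝ] F)) (aux16N K g' a)) a := by
  rw [hasFDerivAt_iff_isLittleO, Asymptotics.isLittleO_iff]
  intro c hc
  obtain ⟨δ, hδ, hd⟩ := aux16N_cont K g' a c hc
  filter_upwards [Metric.ball_mem_nhds a hδ] with b hb
  rw [ContinuousMap.norm_le _ (by positivity)]
  intro t
  have key : ∀ z ∈ segment ℝ (a t) (b t), ‖g' z - g' (a t)‖ ≤ c := by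
    intro z hz
    rw [segment_eq_image'] at hz
    obtain ⟨θ, hθ, rfl⟩ := hz
    have h1 : dist (a + θ • (b - a)) a < δ := by
      rw [dist_eq_norm, add_sub_cancel_left, norm_smul]
      have : ‖b - a‖ < δ := by rwa [← dist_eq_norm]
      have h2 : ‖θ‖ ≤ 1 := by rw [Real.norm_eq_abs, abs_le]; constructor <;> linarith [hθ.1, hθ.2]
      nlinarith [norm_nonneg (b - a), norm_nonneg θ]
    have h3 := hd h1
    rw [dist_eq_norm] at h3
    have h4 := (ContinuousMap.norm_coe_le_norm _ t).trans h3.le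
    simpa [aux16N] using h4
  have := Convex.norm_image_sub_le_of_norm_hasFDerivWithin_le' (𝕜 := ℝ) (f := g) (φ := g' (a t))
    (s := segment ℝ (a t) (b t)) (x := a t) (y := b t)
    (fun x _ => (h x).hasFDerivWithinAt) key (convex_segment _ _) (left_mem_segment _ _ _)
    (right_mem_segment _ _ _)
  refine this.trans ?_
  exact mul_le_mul_of_nonneg_left ((b - a).norm_coe_le_norm t) hc.le

theorem aux16N_contDiff_nat (K : Type) [TopologicalSpace K] [CompactSpace K]
    {E : Type} [NormedAddCommGroup E] [NormedSpace ℝ E] (n : ℕ) :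
    ∀ {F : Type} [NormedAddCommGroup F] [NormedSpace ℝ F] (g : C(E, F)),
      ContDiff ℝ n g → ContDiff ℝ n (aux16N K g) := by
  induction n with
  | zero =>
    intro F _ _ g _
    simp only [Nat.cast_zero, contDiff_zero]
    exact ContinuousMap.continuous_postcomp g
  | succ n ih =>
    intro F _ _ g hg
    have hg' : ContDiff ℝ ((n : WithTop ℕ∞) + 1) g := by exact_mod_cast hg
    rw [contDiff_succ_iff_hasFDerivAt] at hg'
    obtain ⟨g', hg'c, hd⟩ := hg'
    have : ContDiff ℝ ((n : WithTop ℕ∞) + 1) (aux16N K g) := by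
      rw [contDiff_succ_iff_hasFDerivAt]
      let G' : C(E, E →L[ℝ] F) := ⟨g', hg'c.continuous⟩
      exact ⟨fun a => aux16Bil K (ContinuousLinearMap.id ℝ (E →L[ℝ] F)) (aux16N K G' a),
        by
        have := ih G' hg'c
        exact (aux16Bil_contDiff K _ n).comp this, aux16N_hasFDerivAt K g G' hd⟩
    exact_mod_cast this

theorem aux16N_contDiff (K : Type) [TopologicalSpace K] [CompactSpace K]
    {E F : Type} [NormedAddCommGroup E] [NormedSpace ℝ E]
    [NormedAddCommGroup F] [NormedSpace ℝ F] (g : C(E, F))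
    (hg : ContDiff ℝ (⊤ : ℕ∞) g) : ContDiff ℝ (⊤ : ℕ∞) (aux16N K g) := by
  rw [contDiff_infty] at hg ⊢
  exact fun n => aux16N_contDiff_nat K n g (hg n)

/-- Smooth inverse function theorem on a full neighbourhood. -/
theorem aux16_inverse {E F : Type} [NormedAddCommGroup E] [NormedSpace ℝ E] [CompleteSpace E]
    [NormedAddCommGroup F] [NormedSpace ℝ F] (f : E → F) (a : E)
    (hf : ∀ᶠ x in 𝓝 a, ContDiffAt ℝ (⊤ : ℕ∞) f x) (f' : E ≃L[ℝ] F)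
    (hf' : HasFDerivAt f (f' : E →L[ℝ] F) a) :
    ∃ e : OpenPartialHomeomorph E F, a ∈ e.source ∧ (∀ x, e x = f x) ∧
      (∀ x ∈ e.source, ContDiffAt ℝ (⊤ : ℕ∞) f x) ∧
      (∀ y ∈ e.target, ContDiffAt ℝ (⊤ : ℕ∞) e.symm y) := by
  have hfa := hf.self_of_nhds
  have hne : ((⊤ : ℕ∞) : WithTop ℕ∞) ≠ 0 := by simp
  let e0 := hfa.toOpenPartialHomeomorph f hf' hne
  have h1 : ∀ᶠ x in 𝓝 a, ∃ e : E ≃L[ℝ] F, (e : E →L[ℝ] F) = fderiv ℝ f x := by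
    have hc : ContinuousAt (fderiv ℝ f) a :=
      (hfa.fderiv_right (m := 0) (by simp)).continuousAt
    have := f'.nhds
    rw [← hf'.fderiv] at this
    exact hc this
  obtain ⟨W, hWs, hWo, haW⟩ := _root_.mem_nhds_iff.1 (hf.and h1)
  let e := e0.restr W
  have hsrc : e.source = e0.source ∩ W := by
    simp [e, hWo.interior_eq]
  have hcoe : ∀ x, e x = f x := fun x => rfl
  refine ⟨e, ?_, hcoe, ?_, ?_⟩
  · rw [hsrc]; exact ⟨hfa.mem_toOpenPartialHomeomorph_source hf' hne, haW⟩
  · intro x hx; rw [hsrc] at hx; exact (hWs hx.2).1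
  · intro y hy
    have hx := e.map_target hy
    rw [hsrc] at hx
    obtain ⟨hx1, ⟨g, hg⟩⟩ := hWs hx.2
    refine e.contDiffAt_symm hy (f₀' := g) ?_ ?_
    · rw [hg]; exact (hx1.differentiableAt (by simp)).hasFDerivAt
    · exact hx1

theorem aux16_inverse_fin {E F : Type} [NormedAddCommGroup E] [NormedSpace ℝ E]
    [FiniteDimensional ℝ E]
    [NormedAddCommGroup F] [NormedSpace ℝ F] [FiniteDimensional ℝ F]
    (hdim : Module.finrank ℝ E = Module.finrank ℝ F) (f : E → F) (a : E)
    (hf : ∀ᶠ x in 𝓝 a, ContDiffAt ℝ (⊤ : ℕ∞) f x)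
    (hinj : ∀ v, fderiv ℝ f a v = 0 → v = 0) :
    ∃ e : OpenPartialHomeomorph E F, a ∈ e.source ∧ (∀ x, e x = f x) ∧
      (∀ x ∈ e.source, ContDiffAt ℝ (⊤ : ℕ∞) f x) ∧
      (∀ y ∈ e.target, ContDiffAt ℝ (⊤ : ℕ∞) e.symm y) := by
  have := FiniteDimensional.complete ℝ E
  have hi : Function.Injective (fderiv ℝ f a : E →ₗ[ℝ] F) := by
    rw [injective_iff_map_eq_zero]; exact hinj
  let f' := (LinearEquiv.ofInjectiveOfFinrankEq (fderiv ℝ f a : E →ₗ[ℝ] F) hi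
    hdim).toContinuousLinearEquiv
  refine aux16_inverse f a hf f' ?_
  have h := (hf.self_of_nhds.differentiableAt (by simp)).hasFDerivAt
  have : (f' : E →L[ℝ] F) = fderiv ℝ f a := by ext v; rfl
  rwa [this]
end Aux16

section Aux16Flow
open Set Filter Topology Metric

/-- The time interval. -/
abbrev aux16I : Type := Icc (-1 : ℝ) 1

/-- Extension of a continuous function on `[-1, 1]` to the line. -/
noncomputable def aux16ext {E : Type} [TopologicalSpace E] (c : C(aux16I, E)) : ℝ → E :=
  fun t => c (projIcc (-1 : ℝ) 1 (by norm_num) t)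

theorem aux16ext_continuous {E : Type} [TopologicalSpace E] (c : C(aux16I, E)) :
    Continuous (aux16ext c) := c.continuous.comp continuous_projIcc

theorem aux16ext_of_mem {E : Type} [TopologicalSpace E] (c : C(aux16I, E)) (t : aux16I) :
    aux16ext c t = c t := by simp [aux16ext]

/-- Integration from `0`. -/
noncomputable def aux16J (E : Type) [NormedAddCommGroup E] [NormedSpace ℝ E] [CompleteSpace E] :
    C(aux16I, E) →L[ℝ] C(aux16I, E) :=
  LinearMap.mkContinuous
    { toFun := fun c => ⟨fun t => ∫ τ in (0 : ℝ)..t, aux16ext c τ,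
        (intervalIntegral.continuous_primitive
          (fun a b => (aux16ext_continuous c).intervalIntegrable a b) 0).comp
          continuous_subtype_val⟩
      map_add' := by
        intro c d
        ext t
        simp only [ContinuousMap.coe_mk, ContinuousMap.add_apply]
        rw [← intervalIntegral.integral_add
          ((aux16ext_continuous c).intervalIntegrable _ _)
          ((aux16ext_continuous d).intervalIntegrable _ _)]
        rfl
      map_smul' := by
        intro r c
        ext t
        simp only [ContinuousMap.coe_mk, ContinuousMap.smul_apply, RingHom.id_apply]
        rw [← intervalIntegral.integral_smul]
        rfl } 1
    (by
      intro c
      rw [ContinuousMap.norm_le _ (by positivity)]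
      intro t
      simp only [LinearMap.coe_mk, AddHom.coe_mk, ContinuousMap.coe_mk, one_mul]
      refine (intervalIntegral.norm_integral_le_of_norm_le_const (C := ‖c‖)
        (fun x _ => c.norm_coe_le_norm _)).trans ?_
      have : |(t : ℝ) - 0| ≤ 1 := by rw [sub_zero, abs_le]; exact t.2
      nlinarith [norm_nonneg c])

theorem aux16J_apply {E : Type} [NormedAddCommGroup E] [NormedSpace ℝ E] [CompleteSpace E]
    (c : C(aux16I, E)) (t : aux16I) : aux16J E c t = ∫ τ in (0 : ℝ)..t, aux16ext c τ := rfl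

/-- Constants as continuous functions. -/
noncomputable def aux16C (E : Type) [NormedAddCommGroup E] [NormedSpace ℝ E] :
    E →L[ℝ] C(aux16I, E) :=
  LinearMap.mkContinuous
    { toFun := fun x => ContinuousMap.const _ x
      map_add' := by intros; rfl
      map_smul' := by intros; rfl } 1
    (by
      intro c
      rw [ContinuousMap.norm_le _ (by positivity)]
      intro t
      simp only [one_mul]
      exact le_rfl)

theorem aux16C_apply {E : Type} [NormedAddCommGroup E] [NormedSpace ℝ E]
    (x : E) (t : aux16I) : aux16C E x t = x := rfl

/-- Rescaling of time. -/
noncomputable def aux16S {E : Type} [TopologicalSpace E] (t : aux16I) (c : C(aux16I, E)) :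
    C(aux16I, E) :=
  c.comp ⟨fun u => ⟨(t : ℝ) * u, by
    rw [mem_Icc, ← abs_le, abs_mul]
    have h1 := abs_le.2 t.2
    have h2 := abs_le.2 u.2
    exact mul_le_one₀ h1 (abs_nonneg _) h2⟩, by fun_prop⟩

/-- The map whose zero set describes the integral curves. -/
noncomputable def aux16G {E : Type} [NormedAddCommGroup E] [NormedSpace ℝ E] [CompleteSpace E]
    (w : C(E, E)) : E × ℝ × C(aux16I, E) → E × ℝ × C(aux16I, E) :=
  fun q => (q.1, q.2.1, q.2.2 - aux16C E q.1 - q.2.1 • aux16J E (aux16N aux16I w q.2.2))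

theorem aux16G_contDiff {E : Type} [NormedAddCommGroup E] [NormedSpace ℝ E] [CompleteSpace E]
    (w : C(E, E)) (hw : ContDiff ℝ (⊤ : ℕ∞) w) : ContDiff ℝ (⊤ : ℕ∞) (aux16G w) := by
  have h1 : ContDiff ℝ (⊤ : ℕ∞) (fun q : E × ℝ × C(aux16I, E) => aux16J E (aux16N aux16I w q.2.2)) :=
    (aux16J E).contDiff.comp ((aux16N_contDiff aux16I w hw).comp (contDiff_snd.comp contDiff_snd))
  have h2 : ContDiff ℝ (⊤ : ℕ∞) (fun q : E × ℝ × C(aux16I, E) => aux16C E q.1) :=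
    (aux16C E).contDiff.comp contDiff_fst
  have h3 : ContDiff ℝ (⊤ : ℕ∞) (fun q : E × ℝ × C(aux16I, E) => q.2.1) :=
    contDiff_fst.comp contDiff_snd
  have h4 : ContDiff ℝ (⊤ : ℕ∞) (fun q : E × ℝ × C(aux16I, E) => q.2.2) :=
    contDiff_snd.comp contDiff_snd
  exact contDiff_fst.prodMk (h3.prodMk ((h4.sub h2).sub (h3.smul h1)))

/-- The derivative of `aux16G` at a base point. -/
noncomputable def aux16Geq {E : Type} [NormedAddCommGroup E] [NormedSpace ℝ E]
    (k : C(aux16I, E)) :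
    (E × ℝ × C(aux16I, E)) ≃L[ℝ] (E × ℝ × C(aux16I, E)) where
  toFun q := (q.1, q.2.1, q.2.2 - aux16C E q.1 - q.2.1 • k)
  invFun q := (q.1, q.2.1, q.2.2 + aux16C E q.1 + q.2.1 • k)
  left_inv q := by
    refine Prod.ext rfl (Prod.ext rfl ?_)
    simp only
    abel
  right_inv q := by
    refine Prod.ext rfl (Prod.ext rfl ?_)
    simp only
    abel
  map_add' q r := by
    refine Prod.ext rfl (Prod.ext rfl ?_)
    simp only [Prod.fst_add, Prod.snd_add, map_add, add_smul]
    abel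
  map_smul' c q := by
    refine Prod.ext rfl (Prod.ext rfl ?_)
    simp only [Prod.smul_fst, Prod.smul_snd, map_smul, RingHom.id_apply, smul_sub, smul_assoc]
  continuous_toFun := by fun_prop
  continuous_invFun := by fun_prop

theorem aux16G_hasFDerivAt {E : Type} [NormedAddCommGroup E] [NormedSpace ℝ E] [CompleteSpace E]
    (w : C(E, E)) (hw : ContDiff ℝ (⊤ : ℕ∞) w) (p : E) :
    HasFDerivAt (aux16G w) (aux16Geq (aux16J E (aux16N aux16I w (aux16C E p))) :
      (E × ℝ × C(aux16I, E)) →L[ℝ] (E × ℝ × C(aux16I, E))) (p, 0, aux16C E p) := by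
  have h1 : ContDiff ℝ (⊤ : ℕ∞) (fun q : E × ℝ × C(aux16I, E) => aux16J E (aux16N aux16I w q.2.2)) :=
    (aux16J E).contDiff.comp ((aux16N_contDiff aux16I w hw).comp (contDiff_snd.comp contDiff_snd))
  have h1' := (h1.differentiable (by simp) (p, 0, aux16C E p)).hasFDerivAt
  have h0 : HasFDerivAt (fun q : E × ℝ × C(aux16I, E) => q.1) _ (p, 0, aux16C E p) :=
    hasFDerivAt_fst (𝕜 := ℝ)
  have h2 : HasFDerivAt (fun q : E × ℝ × C(aux16I, E) => aux16C E q.1) _ (p, 0, aux16C E p) :=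
    (aux16C E).hasFDerivAt.comp _ h0
  have hs : HasFDerivAt (fun q : E × ℝ × C(aux16I, E) => q.2) _ (p, 0, aux16C E p) :=
    hasFDerivAt_snd (𝕜 := ℝ)
  have h3 : HasFDerivAt (fun q : E × ℝ × C(aux16I, E) => q.2.1) _ (p, 0, aux16C E p) :=
    hs.fst
  have h4 : HasFDerivAt (fun q : E × ℝ × C(aux16I, E) => q.2.2) _ (p, 0, aux16C E p) :=
    hs.snd
  have := h0.prodMk (h3.prodMk ((h4.sub h2).sub (h3.smul h1')))
  refine this.congr_fderiv ?_
  ext q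
  all_goals simp [aux16Geq]

/-- Smooth local flow. -/
theorem aux16_flow {E : Type} [NormedAddCommGroup E] [NormedSpace ℝ E] [CompleteSpace E]
    (w : E → E) (hw : ContDiff ℝ (⊤ : ℕ∞) w) (p : E) :
    ∃ (φ : E × ℝ → E) (δ : ℝ), 0 < δ ∧
      (∀ x ∈ ball p δ, ∀ s ∈ ball (0 : ℝ) δ, ContDiffAt ℝ (⊤ : ℕ∞) φ (x, s)) ∧
      (∀ x ∈ ball p δ, φ (x, 0) = x) ∧
      (∀ x ∈ ball p δ, ∀ s ∈ ball (0 : ℝ) δ,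
        HasDerivAt (fun u => φ (x, u)) (w (φ (x, s))) s) := by
  let W : C(E, E) := ⟨w, hw.continuous⟩
  obtain ⟨e, hae, hcoe, -, hsm⟩ := aux16_inverse (aux16G W) (p, 0, aux16C E p)
    (Eventually.of_forall fun x => (aux16G_contDiff W hw).contDiffAt) _
    (aux16G_hasFDerivAt W hw p)
  have hbase : e (p, 0, aux16C E p) = (p, 0, 0) := by
    rw [hcoe]; simp [aux16G]
  let γ : E × ℝ → C(aux16I, E) := fun z => (e.symm (z.1, z.2, 0)).2.2
  have hγbase : γ (p, 0) = aux16C E p := by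
    change (e.symm (p, 0, 0)).2.2 = _
    rw [← hbase, e.left_inv hae]
  obtain ⟨r, hr, hball⟩ := Metric.mem_nhds_iff.1 (e.open_source.mem_nhds hae)
  have hsrc : ∀ x s c, dist x p < r → dist s 0 < r → dist c (aux16C E p) < r →
      ((x, s, c) : E × ℝ × C(aux16I, E)) ∈ e.source := by
    intro x s c h1 h2 h3
    apply hball
    rw [mem_ball, Prod.dist_eq, Prod.dist_eq]
    exact max_lt h1 (max_lt h2 h3)
  let ι : E × ℝ → E × ℝ × C(aux16I, E) := fun z => (z.1, z.2, 0)
  have hι : ContDiff ℝ (⊤ : ℕ∞) ι := contDiff_fst.prodMk (contDiff_snd.prodMk contDiff_const)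
  have htb : ι (p, 0) ∈ e.target := by
    have := e.map_source hae
    rwa [hbase] at this
  have hγsm : ∀ z, ι z ∈ e.target → ContDiffAt ℝ (⊤ : ℕ∞) γ z := by
    intro z hz
    have h1 : ContDiffAt ℝ (⊤ : ℕ∞) (fun z => e.symm (ι z)) z :=
      (hsm _ hz).comp z hι.contDiffAt
    exact h1.snd.snd
  have hev1 : ∀ᶠ z in 𝓝 (p, (0 : ℝ)), ι z ∈ e.target :=
    hι.continuous.continuousAt.eventually (e.open_target.mem_nhds htb)
  have hev2 : ∀ᶠ z in 𝓝 (p, (0 : ℝ)), dist (γ z) (aux16C E p) < r := by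
    have hc := (hγsm _ htb).continuousAt
    have := hc.eventually (Metric.ball_mem_nhds _ hr)
    rwa [hγbase] at this
  obtain ⟨d, hd, hdb⟩ := Metric.mem_nhds_iff.1 (hev1.and hev2)
  let δ := min d r
  have hδ : 0 < δ := lt_min hd hr
  have hin : ∀ x ∈ ball p δ, ∀ s ∈ ball (0 : ℝ) δ, ι (x, s) ∈ e.target ∧
      dist (γ (x, s)) (aux16C E p) < r := by
    intro x hx s hs
    apply hdb
    rw [mem_ball, Prod.dist_eq]
    exact max_lt ((mem_ball.1 hx).trans_le (min_le_left _ _))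
      ((mem_ball.1 hs).trans_le (min_le_left _ _))
  have heq : ∀ x ∈ ball p δ, ∀ s ∈ ball (0 : ℝ) δ,
      γ (x, s) = aux16C E x + s • aux16J E (aux16N aux16I W (γ (x, s))) := by
    intro x hx s hs
    have h1 := e.right_inv (hin x hx s hs).1
    rw [hcoe] at h1
    have ha : (e.symm (ι (x, s))).1 = x := congrArg Prod.fst h1
    have hb : (e.symm (ι (x, s))).2.1 = s := congrArg (fun q => q.2.1) h1
    have hc := congrArg (fun q => q.2.2) h1
    simp only [aux16G, ha, hb] at hc
    have hc' : γ (x, s) - aux16C E x - s • aux16J E (aux16N aux16I W (γ (x, s))) = 0 := hc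
    rw [sub_sub, sub_eq_zero] at hc'
    exact hc'
  have huniq : ∀ x ∈ ball p δ, ∀ s ∈ ball (0 : ℝ) δ, ∀ c : C(aux16I, E),
      dist c (aux16C E p) < r → c = aux16C E x + s • aux16J E (aux16N aux16I W c) →
      c = γ (x, s) := by
    intro x hx s hs c hc h
    have h1 := hsrc x s c ((mem_ball.1 hx).trans_le (min_le_right _ _))
      ((mem_ball.1 hs).trans_le (min_le_right _ _)) hc
    have h2 : e (x, s, c) = (x, s, 0) := by
      rw [hcoe]
      simp only [aux16G]
      rw [sub_sub, ← h, sub_self]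
    have h3 := e.left_inv h1
    rw [h2] at h3
    exact (congrArg (fun q => q.2.2) h3).symm
  have hscale : ∀ x ∈ ball p δ, ∀ s ∈ ball (0 : ℝ) δ, ∀ t : aux16I,
      γ (x, s * t) = aux16S t (γ (x, s)) := by
    intro x hx s hs t
    symm
    have ht1 : |(t : ℝ)| ≤ 1 := abs_le.2 t.2
    apply huniq x hx
    · rw [mem_ball_zero_iff, Real.norm_eq_abs] at hs ⊢
      rw [abs_mul]
      nlinarith [abs_nonneg s]
    · refine lt_of_le_of_lt ?_ (hin x hx s hs).2
      rw [ContinuousMap.dist_le dist_nonneg]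
      intro u
      exact (γ (x, s)).dist_apply_le_dist (g := aux16C E p) _
    · ext u
      have h := congrArg (fun c : C(aux16I, E) => aux16S t c u) (heq x hx s hs)
      refine h.trans ?_
      have hJ : aux16S t (aux16J E (aux16N aux16I W (γ (x, s)))) u
          = (t : ℝ) • aux16J E (aux16N aux16I W (aux16S t (γ (x, s)))) u := by
        rw [aux16J_apply]
        change (∫ τ in (0 : ℝ)..((t : ℝ) * u), aux16ext (aux16N aux16I W (γ (x, s))) τ) = _
        have h0 : (0 : ℝ) = t * 0 := by simp
        conv_lhs => rw [h0]
        rw [← intervalIntegral.smul_integral_comp_mul_left]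
        congr 1
        apply intervalIntegral.integral_congr
        intro τ hτ
        have hτ' : τ ∈ Icc (-1 : ℝ) 1 := by
          have : uIcc (0 : ℝ) u ⊆ Icc (-1 : ℝ) 1 :=
            (ordConnected_Icc).uIcc_subset (by simp) u.2
          exact this hτ
        have e1 := aux16ext_of_mem (aux16N aux16I W (aux16S t (γ (x, s)))) ⟨τ, hτ'⟩
        have hm : (t : ℝ) * τ ∈ Icc (-1 : ℝ) 1 := by
          rw [mem_Icc, ← abs_le, abs_mul]
          exact mul_le_one₀ ht1 (abs_nonneg _) (abs_le.2 hτ')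
        have e2 := aux16ext_of_mem (aux16N aux16I W (γ (x, s))) ⟨t * τ, hm⟩
        exact e2.trans e1.symm
      change x + s • aux16S t (aux16J E (aux16N aux16I W (γ (x, s)))) u = _
      rw [hJ, smul_smul]
      rfl
  let one : aux16I := ⟨1, by norm_num⟩
  let ev : C(aux16I, E) →L[ℝ] E := ContinuousMap.evalCLM ℝ one
  have hsub : ∀ x ∈ ball p δ, ∀ s ∈ ball (0 : ℝ) δ, ∀ t : aux16I,
      ev (γ (x, s * t)) = x + s • ∫ τ in (0 : ℝ)..t, aux16ext (aux16N aux16I W (γ (x, s))) τ := by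
    intro x hx s hs t
    rw [hscale x hx s hs t]
    have h := congrArg (fun c : C(aux16I, E) => c t) (heq x hx s hs)
    have h2 : ev (aux16S t (γ (x, s))) = γ (x, s) t := by
      change γ (x, s) ⟨(t : ℝ) * (1 : ℝ), _⟩ = _
      congr 1
      ext
      simp
    rw [h2]
    exact h
  have hsub2 : ∀ x ∈ ball p δ, ∀ s ∈ ball (0 : ℝ) δ, ∀ t : aux16I,
      ev (γ (x, s * t)) = γ (x, s) t := by
    intro x hx s hs t
    rw [hsub x hx s hs t]
    exact (congrArg (fun c : C(aux16I, E) => c t) (heq x hx s hs)).symm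
  refine ⟨fun z => ev (γ z), δ, hδ, ?_, ?_, ?_⟩
  · intro x hx s hs
    exact ev.contDiff.contDiffAt.comp (x, s) (hγsm _ (hin x hx s hs).1)
  · intro x hx
    have := hsub x hx 0 (mem_ball_self hδ) one
    simpa using this
  · intro x hx s hs
    rw [mem_ball_zero_iff, Real.norm_eq_abs] at hs
    obtain ⟨σ, h1, h2⟩ := exists_between hs
    have hσ : 0 < σ := (abs_nonneg s).trans_lt h1
    have hσb : σ ∈ ball (0 : ℝ) δ := by
      rw [mem_ball_zero_iff, Real.norm_eq_abs, abs_of_pos hσ]; exact h2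
    have hmem : ∀ u : ℝ, |u| < σ → u / σ ∈ Icc (-1 : ℝ) 1 := by
      intro u hu
      rw [mem_Icc, ← abs_le, abs_div, abs_of_pos hσ, div_le_one hσ]
      exact hu.le
    have hev : (fun u => ev (γ (x, u))) =ᶠ[𝓝 s] fun u =>
        x + σ • ∫ τ in (0 : ℝ)..(u / σ), aux16ext (aux16N aux16I W (γ (x, σ))) τ := by
      have : ∀ᶠ u in 𝓝 s, |u| < σ := (continuous_abs.tendsto s).eventually (gt_mem_nhds h1)
      filter_upwards [this] with u hu
      have := hsub x hx σ hσb ⟨u / σ, hmem u hu⟩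
      simp only [mul_div_cancel₀ _ hσ.ne'] at this
      rw [← this]
    have hval : aux16ext (aux16N aux16I W (γ (x, σ))) (s / σ) = w (ev (γ (x, s))) := by
      have e1 := aux16ext_of_mem (aux16N aux16I W (γ (x, σ))) ⟨s / σ, hmem s h1⟩
      have e2 := hsub2 x hx σ hσb ⟨s / σ, hmem s h1⟩
      have e3 : σ * (s / σ) = s := by field_simp
      simp only [e3] at e2
      rw [e2]
      exact e1
    refine HasDerivAt.congr_of_eventuallyEq ?_ hev
    have hcont := aux16ext_continuous (aux16N aux16I W (γ (x, σ)))
    have hF := (hcont.integral_hasStrictDerivAt 0 (s / σ)).hasDerivAt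
    have hdiv : HasDerivAt (fun u : ℝ => u / σ) (1 / σ) s := (hasDerivAt_id s).div_const σ
    have := ((hF.scomp s hdiv).const_smul σ).const_add x
    rw [hval, smul_smul, mul_one_div_cancel hσ.ne', one_smul] at this
    exact this

end Aux16Flow

section Aux16Final
open Set Filter Topology Metric

theorem aux16_cutoff {E F : Type} [NormedAddCommGroup E] [NormedSpace ℝ E]
    [FiniteDimensional ℝ E] [NormedAddCommGroup F] [NormedSpace ℝ F] (v : E → F) (p : E)
    (hv : ∀ᶠ x in 𝓝 p, ContDiffAt ℝ (⊤ : ℕ∞) v x) :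
    ∃ w : E → F, ContDiff ℝ (⊤ : ℕ∞) w ∧ w =ᶠ[𝓝 p] v := by
  obtain ⟨r, hr, hb⟩ := Metric.mem_nhds_iff.1 hv
  let χ : ContDiffBump p := ⟨r / 4, r / 2, by linarith, by linarith⟩
  refine ⟨fun x => χ x • v x, ?_, ?_⟩
  · rw [contDiff_iff_contDiffAt]
    intro x
    by_cases hx : x ∈ ball p r
    · exact χ.contDiff.contDiffAt.smul (hb hx)
    · have hx' : x ∈ (closedBall p (r / 2))ᶜ := by
        intro h
        apply hx
        rw [mem_closedBall] at h
        rw [mem_ball]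
        linarith
      have : (fun x => χ x • v x) =ᶠ[𝓝 x] fun _ => 0 := by
        filter_upwards [isClosed_closedBall.isOpen_compl.mem_nhds hx'] with y hy
        have : χ y = 0 := by
          apply χ.zero_of_le_dist
          rw [mem_compl_iff, mem_closedBall, not_le] at hy
          exact hy.le
        simp [this]
      exact contDiffAt_const.congr_of_eventuallyEq this
  · filter_upwards [χ.eventuallyEq_one] with x hx
    rw [hx]; simp

theorem aux16_first_integral (v : (Fin 2 → ℝ) → (Fin 2 → ℝ)) (p : Fin 2 → ℝ)
    (hv : ∀ᶠ x in 𝓝 p, ContDiffAt ℝ (⊤ : ℕ∞) v x) (hp : v p ≠ 0) :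
    ∃ h : (Fin 2 → ℝ) → ℝ, (∀ᶠ x in 𝓝 p, ContDiffAt ℝ (⊤ : ℕ∞) h x ∧ fderiv ℝ h x (v x) = 0) ∧
      ∃ u, fderiv ℝ h p u ≠ 0 := by
  obtain ⟨w, hw, hwv⟩ := aux16_cutoff v p hv
  have hwp : w p = v p := hwv.self_of_nhds
  obtain ⟨φ, δ, hδ, hsm, h0, hd⟩ := aux16_flow w hw p
  let u : Fin 2 → ℝ := ![- v p 1, v p 0]
  let Ψ : ℝ × ℝ → (Fin 2 → ℝ) := fun z => φ (p + z.2 • u, z.1)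
  let A : ℝ × ℝ → (Fin 2 → ℝ) × ℝ := fun z => (p + z.2 • u, z.1)
  have hA : ContDiff ℝ (⊤ : ℕ∞) A :=
    (contDiff_const.add (contDiff_snd.smul contDiff_const)).prodMk contDiff_fst
  have hA0 : A (0, 0) = (p, 0) := by simp [A]
  have hnear : ∀ᶠ z in 𝓝 ((0, 0) : ℝ × ℝ), (A z).1 ∈ ball p δ ∧ (A z).2 ∈ ball (0 : ℝ) δ := by
    have hc : ContinuousAt A (0, 0) := hA.continuous.continuousAt
    have : ball p δ ×ˢ ball (0 : ℝ) δ ∈ 𝓝 (A (0, 0)) := by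
      rw [hA0]; exact prod_mem_nhds (ball_mem_nhds _ hδ) (ball_mem_nhds _ hδ)
    exact hc this
  have hΨsm : ∀ᶠ z in 𝓝 ((0, 0) : ℝ × ℝ), ContDiffAt ℝ (⊤ : ℕ∞) Ψ z := by
    filter_upwards [hnear] with z hz
    exact (hsm _ hz.1 _ hz.2).comp z hA.contDiffAt
  have hΨ0 : Ψ (0, 0) = p := by
    have := h0 p (mem_ball_self hδ)
    simpa [Ψ] using this
  have hΨd := (hΨsm.self_of_nhds.differentiableAt (by simp)).hasFDerivAt
  have hD1 : fderiv ℝ Ψ (0, 0) (1, 0) = v p := by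
    have hl : HasDerivAt (fun s : ℝ => ((s, 0) : ℝ × ℝ)) (1, 0) 0 :=
      (hasDerivAt_id _).prodMk (hasDerivAt_const _ _)
    have h1 := HasFDerivAt.comp_hasDerivAt (f := fun s : ℝ => ((s, 0) : ℝ × ℝ)) (0 : ℝ) hΨd hl
    have h2 := hd p (mem_ball_self hδ) 0 (mem_ball_self hδ)
    rw [h0 p (mem_ball_self hδ), hwp] at h2
    have h3 : (Ψ ∘ fun s : ℝ => ((s, 0) : ℝ × ℝ)) = fun s => φ (p, s) := by
      funext s; simp [Ψ]
    rw [h3] at h1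
    exact h1.unique h2
  have hD2 : fderiv ℝ Ψ (0, 0) (0, 1) = u := by
    have hl : HasDerivAt (fun s : ℝ => ((0, s) : ℝ × ℝ)) (0, 1) 0 :=
      (hasDerivAt_const _ _).prodMk (hasDerivAt_id _)
    have h1 := hΨd.comp_hasDerivAt (0 : ℝ) hl
    have h2 : HasDerivAt (fun s : ℝ => p + s • u) ((1 : ℝ) • u) 0 :=
      ((hasDerivAt_id (0 : ℝ)).smul_const u).const_add p
    rw [one_smul] at h2
    have h3 : (Ψ ∘ fun s : ℝ => ((0, s) : ℝ × ℝ)) =ᶠ[𝓝 0] fun s => p + s • u := by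
      have hc : ContinuousAt (fun s : ℝ => ((0, s) : ℝ × ℝ)) 0 := hl.continuousAt
      filter_upwards [hc.eventually hnear] with s hs
      exact h0 _ hs.1
    exact h1.unique (h2.congr_of_eventuallyEq h3)
  have hinj : ∀ z, fderiv ℝ Ψ (0, 0) z = 0 → z = 0 := by
    rintro ⟨a, b⟩ hz
    have hz2 : ((a, b) : ℝ × ℝ) = a • ((1, 0) : ℝ × ℝ) + b • ((0, 1) : ℝ × ℝ) := by simp
    rw [hz2, map_add, map_smul, map_smul, hD1, hD2] at hz
    have e0 := congrFun hz 0
    have e1 := congrFun hz 1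
    simp [u] at e0 e1
    have hpos : 0 < v p 0 ^ 2 + v p 1 ^ 2 := by
      by_contra hcon
      apply hp
      have a0 : v p 0 = 0 := by nlinarith [sq_nonneg (v p 0), sq_nonneg (v p 1)]
      have a1 : v p 1 = 0 := by nlinarith [sq_nonneg (v p 0), sq_nonneg (v p 1)]
      funext i
      fin_cases i
      · exact a0
      · exact a1
    have ha : a * (v p 0 ^ 2 + v p 1 ^ 2) = 0 := by linear_combination v p 0 * e0 + v p 1 * e1
    have hb : b * (v p 0 ^ 2 + v p 1 ^ 2) = 0 := by linear_combination v p 0 * e1 - v p 1 * e0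
    have ha' := (mul_eq_zero.1 ha).resolve_right hpos.ne'
    have hb' := (mul_eq_zero.1 hb).resolve_right hpos.ne'
    rw [ha', hb']; rfl
  obtain ⟨e, hae, hcoe, -, hesm⟩ := aux16_inverse_fin (by simp) Ψ (0, 0) hΨsm hinj
  have hpt : p ∈ e.target := by
    have := e.map_source hae
    rwa [hcoe, hΨ0] at this
  have hep : e.symm p = (0, 0) := by
    have := e.left_inv hae
    rwa [hcoe, hΨ0] at this
  refine ⟨fun x => (e.symm x).2, ?_, u, ?_⟩
  · have hc : ContinuousAt e.symm p := (hesm p hpt).continuousAt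
    have hn : ∀ᶠ x in 𝓝 p, (A (e.symm x)).1 ∈ ball p δ ∧ (A (e.symm x)).2 ∈ ball (0 : ℝ) δ := by
      rw [← hep] at hnear
      exact hc.eventually hnear
    filter_upwards [hn, e.open_target.mem_nhds hpt, hwv] with x hx hxt hwx
    refine ⟨(hesm x hxt).snd, ?_⟩
    rw [← hwx]
    have hdf := ((hesm x hxt).snd.differentiableAt (by simp)).hasFDerivAt
    have hxe : φ (A (e.symm x)) = x := by
      have := e.right_inv hxt
      rwa [hcoe] at this
    set z := e.symm x with hz
    have h2 := hd _ hx.1 _ hx.2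
    have hxe' : φ ((A z).1, (A z).2) = x := hxe
    rw [hxe'] at h2
    rw [← hxe'] at hdf
    have h3 := hdf.comp_hasDerivAt _ h2
    have h4 : ((fun x => (e.symm x).2) ∘ fun s => φ ((A z).1, s)) =ᶠ[𝓝 (A z).2] fun _ => z.2 := by
      have hcs : ContinuousAt (fun s : ℝ => ((s, z.2) : ℝ × ℝ)) z.1 := by fun_prop
      have hzs : z ∈ e.source := e.map_target hxt
      filter_upwards [hcs.eventually (e.open_source.mem_nhds hzs)] with s hs
      have := e.left_inv hs
      rw [hcoe] at this
      have this2 : (e.symm (Ψ (s, z.2))).2 = z.2 := by rw [this]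
      exact this2
    have h5 := h3.unique ((hasDerivAt_const _ _).congr_of_eventuallyEq h4)
    rw [hxe'] at h5
    exact h5
  · have hdf := ((hesm p hpt).snd.differentiableAt (by simp)).hasFDerivAt
    have hl : HasDerivAt (fun s : ℝ => ((0, s) : ℝ × ℝ)) (0, 1) 0 :=
      (hasDerivAt_const _ _).prodMk (hasDerivAt_id _)
    have h1 := hΨd.comp_hasDerivAt (0 : ℝ) hl
    rw [hD2] at h1
    have hdf' := hdf
    rw [← hΨ0] at hdf
    have h3 := hdf.comp_hasDerivAt (0 : ℝ) h1
    have h4 : ((fun x => (e.symm x).2) ∘ (Ψ ∘ fun s : ℝ => ((0, s) : ℝ × ℝ))) =ᶠ[𝓝 0]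
        fun s => s := by
      have hc : ContinuousAt (fun s : ℝ => ((0, s) : ℝ × ℝ)) 0 := hl.continuousAt
      filter_upwards [hc.eventually (e.open_source.mem_nhds hae)] with s hs
      have := e.left_inv hs
      rw [hcoe] at this
      exact congrArg Prod.snd this
    have h5 := h3.unique ((hasDerivAt_id _).congr_of_eventuallyEq h4)
    rw [hΨ0] at h5
    rw [h5]
    exact one_ne_zero

theorem aux16_matrix (J L : Matrix (Fin 2) (Fin 2) ℝ) (hJ : IsUnit J.det) (v : Fin 2 → ℝ) (l : ℝ)
    (hv : v ≠ 0) (hL : L.mulVec v = l • v) (r c : Fin 2) (hrc : r ≠ c)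
    (hk : J.mulVec v r = 0) : (J * L * J⁻¹) r c = 0 := by
  have h1 : (J * L * J⁻¹).mulVec (J.mulVec v) = l • J.mulVec v := by
    rw [Matrix.mulVec_mulVec, Matrix.mul_assoc, Matrix.nonsing_inv_mul _ hJ, Matrix.mul_one,
      ← Matrix.mulVec_mulVec, hL, Matrix.mulVec_smul]
  have hJv : J.mulVec v ≠ 0 := by
    intro h
    apply hv
    have := congrArg (J⁻¹.mulVec) h
    rwa [Matrix.mulVec_mulVec, Matrix.nonsing_inv_mul _ hJ, Matrix.one_mulVec,
      Matrix.mulVec_zero] at this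
  have hc : J.mulVec v = Pi.single c (J.mulVec v c) := by
    funext i
    by_cases hi : i = c
    · subst hi; simp
    · have : i = r := by omega
      subst this
      rw [hk, Pi.single_eq_of_ne hi]
  have hcne : J.mulVec v c ≠ 0 := by
    intro h
    apply hJv
    rw [hc, h]; simp
  have h2 := congrFun h1 r
  rw [Pi.smul_apply, hk, smul_zero, hc, Matrix.mulVec_single] at h2
  have h3 : (J * L * J⁻¹) r c * J.mulVec v c = 0 := h2
  exact (mul_eq_zero.1 h3).resolve_right hcne

end Aux16Final

section Aux16Main
open Set Filter Topology Metric

theorem aux16_cross (a b x0 x1 y0 y1 : ℝ) (hab : a ≠ 0 ∨ b ≠ 0) (hx : a * x0 + b * x1 = 0)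
    (hy : a * y0 + b * y1 = 0) : x0 * y1 - x1 * y0 = 0 := by
  rcases hab with h | h
  · have : a * (x0 * y1 - x1 * y0) = 0 := by linear_combination y1 * hx - x1 * hy
    exact (mul_eq_zero.1 this).resolve_left h
  · have : b * (x0 * y1 - x1 * y0) = 0 := by linear_combination x0 * hy - y0 * hx
    exact (mul_eq_zero.1 this).resolve_left h

theorem aux16_ne_zero (w : Fin 2 → ℝ) (hw : w ≠ 0) : w 0 ≠ 0 ∨ w 1 ≠ 0 := by
  by_contra h
  push Not at h
  apply hw
  funext i
  fin_cases i
  · exact h.1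
  · exact h.2

theorem aux16_eig (L : Matrix (Fin 2) (Fin 2) ℝ) (v w : Fin 2 → ℝ) (a b : ℝ) (hab : a ≠ b)
    (hv : v ≠ 0) (hw : w ≠ 0) (hLv : L.mulVec v = a • v) (hLw : L.mulVec w = b • w) :
    v 0 * w 1 - v 1 * w 0 ≠ 0 := by
  intro h
  have v0 := congrFun hLv 0
  have v1 := congrFun hLv 1
  have w0 := congrFun hLw 0
  have w1 := congrFun hLw 1
  simp [Matrix.mulVec, dotProduct, Fin.sum_univ_two] at v0 v1 w0 w1
  have hab' : a - b ≠ 0 := sub_ne_zero.2 hab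
  have e00 : v 0 * w 0 = 0 := by
    refine (mul_eq_zero.1 (?_ : (a - b) * (v 0 * w 0) = 0)).resolve_left hab'
    linear_combination L 0 1 * (-h) - w 0 * v0 + v 0 * w0
  have e11 : v 1 * w 1 = 0 := by
    refine (mul_eq_zero.1 (?_ : (a - b) * (v 1 * w 1) = 0)).resolve_left hab'
    linear_combination L 1 0 * h - w 1 * v1 + v 1 * w1
  have e01 : v 0 * w 1 = 0 := by
    refine (mul_eq_zero.1 (?_ : (a - b) * (v 0 * w 1) = 0)).resolve_left hab'
    linear_combination (-b) * h - w 1 * v0 + v 1 * w0 + L 0 0 * h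
  have e10 : v 1 * w 0 = 0 := by linear_combination e01 - h
  rcases aux16_ne_zero v hv with h0 | h0 <;> rcases aux16_ne_zero w hw with h1 | h1 <;>
    simp_all

theorem aux16_disc (L : Matrix (Fin 2) (Fin 2) ℝ) (v w : Fin 2 → ℝ) (a b : ℝ) (hab : a ≠ b)
    (hv : v ≠ 0) (hw : w ≠ 0) (hLv : L.mulVec v = a • v) (hLw : L.mulVec w = b • w) :
    0 < (L 0 0 - L 1 1) ^ 2 + 4 * (L 0 1 * L 1 0) := by
  have key : ∀ (v : Fin 2 → ℝ) (a : ℝ), v ≠ 0 → L.mulVec v = a • v →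
      (L 0 0 - a) * (L 1 1 - a) - L 0 1 * L 1 0 = 0 := by
    intro v a hv hLv
    have v0 := congrFun hLv 0
    have v1 := congrFun hLv 1
    simp [Matrix.mulVec, dotProduct, Fin.sum_univ_two] at v0 v1
    rcases aux16_ne_zero v hv with h | h
    · refine (mul_eq_zero.1 (?_ : v 0 * _ = 0)).resolve_left h
      linear_combination (L 1 1 - a) * v0 - L 0 1 * v1
    · refine (mul_eq_zero.1 (?_ : v 1 * _ = 0)).resolve_left h
      linear_combination (L 0 0 - a) * v1 - L 1 0 * v0
  have k1 := key v a hv hLv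
  have k2 := key w b hw hLw
  have hT : L 0 0 + L 1 1 = a + b := by
    have : (a - b) * (L 0 0 + L 1 1 - (a + b)) = 0 := by linear_combination k2 - k1
    have := (mul_eq_zero.1 this).resolve_left (sub_ne_zero.2 hab)
    linarith
  have : (L 0 0 - L 1 1) ^ 2 + 4 * (L 0 1 * L 1 0) = (a - b) ^ 2 := by
    have hb : L 1 1 = a + b - L 0 0 := by linarith
    rw [hb] at k1 ⊢
    linear_combination -4 * k1
  rw [this]
  exact sq_pos_of_ne_zero (sub_ne_zero.2 hab)

end Aux16Main

section Aux16End
open Set Filter Topology Metric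

theorem aux16_eigfield (U : Set (Fin 2 → ℝ)) (hU : IsOpen U)
    (L : (Fin 2 → ℝ) → Matrix (Fin 2) (Fin 2) ℝ)
    (hL : ∀ r c, ContDiffOn ℝ (⊤ : ℕ∞) (fun x => L x r c) U)
    (hD : ∀ x ∈ U, 0 < (L x 0 0 - L x 1 1) ^ 2 + 4 * (L x 0 1 * L x 1 0))
    (p : Fin 2 → ℝ) (hp : p ∈ U) (ε : ℝ) (hε : ε ^ 2 = 1) :
    ∃ v : (Fin 2 → ℝ) → (Fin 2 → ℝ), ∀ᶠ x in 𝓝 p, ContDiffAt ℝ (⊤ : ℕ∞) v x ∧ v x ≠ 0 ∧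
      (L x).mulVec (v x) = ((L x 0 0 + L x 1 1
        - ε * √((L x 0 0 - L x 1 1) ^ 2 + 4 * (L x 0 1 * L x 1 0))) / 2) • v x := by
  let D : (Fin 2 → ℝ) → ℝ := fun x => (L x 0 0 - L x 1 1) ^ 2 + 4 * (L x 0 1 * L x 1 0)
  let l : (Fin 2 → ℝ) → ℝ := fun x => (L x 0 0 + L x 1 1 + ε * √(D x)) / 2
  have hLat : ∀ x ∈ U, ∀ r c, ContDiffAt ℝ (⊤ : ℕ∞) (fun x => L x r c) x :=
    fun x hx r c => (hL r c).contDiffAt (hU.mem_nhds hx)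
  have hDs : ∀ x ∈ U, ContDiffAt ℝ (⊤ : ℕ∞) D x := fun x hx =>
    (((hLat x hx 0 0).sub (hLat x hx 1 1)).pow 2).add
      (contDiffAt_const.mul ((hLat x hx 0 1).mul (hLat x hx 1 0)))
  have hls : ∀ x ∈ U, ContDiffAt ℝ (⊤ : ℕ∞) l x := fun x hx =>
    (((hLat x hx 0 0).add (hLat x hx 1 1)).add
      (contDiffAt_const.mul ((hDs x hx).sqrt (hD x hx).ne'))).div_const 2
  have hu : ∃ u : Fin 2 → ℝ, ![(L p 0 0 - l p) * u 0 + L p 0 1 * u 1,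
      L p 1 0 * u 0 + (L p 1 1 - l p) * u 1] ≠ 0 := by
    by_contra hcon
    push Not at hcon
    have c1 := hcon ![1, 0]
    have c2 := hcon ![0, 1]
    have c10 := congrFun c1 0
    have c11 := congrFun c1 1
    have c20 := congrFun c2 0
    have c21 := congrFun c2 1
    simp at c10 c11 c20 c21
    have := hD p hp
    have h0 : L p 0 0 - L p 1 1 = 0 := by linarith
    rw [h0, c11, c20] at this
    simp at this
  obtain ⟨u, hu⟩ := hu
  let v : (Fin 2 → ℝ) → (Fin 2 → ℝ) := fun x => ![(L x 0 0 - l x) * u 0 + L x 0 1 * u 1,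
      L x 1 0 * u 0 + (L x 1 1 - l x) * u 1]
  have hvs : ∀ x ∈ U, ContDiffAt ℝ (⊤ : ℕ∞) v x := by
    intro x hx
    rw [contDiffAt_pi]
    intro i
    fin_cases i
    · exact (((hLat x hx 0 0).sub (hls x hx)).mul contDiffAt_const).add
        ((hLat x hx 0 1).mul contDiffAt_const)
    · exact ((hLat x hx 1 0).mul contDiffAt_const).add
        (((hLat x hx 1 1).sub (hls x hx)).mul contDiffAt_const)
  refine ⟨v, ?_⟩
  filter_upwards [hU.mem_nhds hp, (hvs p hp).continuousAt.eventually_ne hu] with x hx hne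
  refine ⟨hvs x hx, hne, ?_⟩
  have hsq : √(D x) ^ 2 = D x := Real.sq_sqrt (hD x hx).le
  have hDx : D x = (L x 0 0 - L x 1 1) ^ 2 + 4 * (L x 0 1 * L x 1 0) := rfl
  rw [← hDx]
  have hlx : l x = (L x 0 0 + L x 1 1 + ε * √(D x)) / 2 := rfl
  have hch : (ε * √(D x)) ^ 2 = (L x 0 0 - L x 1 1) ^ 2 + 4 * (L x 0 1 * L x 1 0) := by
    rw [mul_pow, hε, hsq, one_mul]
  generalize ε * √(D x) = s at *
  funext i
  fin_cases i
  · simp [Matrix.mulVec, dotProduct, Fin.sum_univ_two, v, hlx]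
    linear_combination (-(u 0) / 4) * hch
  · simp [Matrix.mulVec, dotProduct, Fin.sum_univ_two, v, hlx]
    linear_combination (-(u 1) / 4) * hch

theorem aux16_jac (f : (Fin 2 → ℝ) → (Fin 2 → ℝ)) (x w : Fin 2 → ℝ) (r : Fin 2) :
    (Matrix.of fun a b => fderiv ℝ (fun y => f y a) x (Pi.single b 1) :
      Matrix (Fin 2) (Fin 2) ℝ).mulVec w r = fderiv ℝ (fun y => f y r) x w := by
  have hw : w = w 0 • Pi.single 0 1 + w 1 • Pi.single 1 1 := by
    funext i; fin_cases i <;> simp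
  conv_rhs => rw [hw, map_add, map_smul, map_smul]
  simp [Matrix.mulVec, dotProduct, Fin.sum_univ_two, mul_comm]

end Aux16End

theorem stmt16 (U : Set (Fin 2 → ℝ)) (hU : IsOpen U)
    (L : (Fin 2 → ℝ) → Matrix (Fin 2) (Fin 2) ℝ)
    (hL : ∀ r c, ContDiffOn ℝ (⊤ : ℕ∞) (fun x => L x r c) U)
    (hev : ∀ x ∈ U, ∃ (a b : ℝ) (v w : Fin 2 → ℝ), a ≠ b ∧ v ≠ 0 ∧ w ≠ 0 ∧
      (L x).mulVec v = a • v ∧ (L x).mulVec w = b • w)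
    (p : Fin 2 → ℝ) (hp : p ∈ U) :
    ∃ (V : Set (Fin 2 → ℝ)) (Φ : (Fin 2 → ℝ) → (Fin 2 → ℝ)),
      IsOpen V ∧ p ∈ V ∧ V ⊆ U ∧
      ContDiffOn ℝ (⊤ : ℕ∞) Φ V ∧ Set.InjOn Φ V ∧
      (∀ x ∈ V, IsUnit (Matrix.of fun r c =>
        fderiv ℝ (fun y => Φ y r) x (Pi.single c 1) : Matrix (Fin 2) (Fin 2) ℝ).det) ∧
      (∀ x ∈ V, ∀ r c : Fin 2, r ≠ c →
        ((Matrix.of fun a b =>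
            fderiv ℝ (fun y => Φ y a) x (Pi.single b 1) : Matrix (Fin 2) (Fin 2) ℝ)
          * L x
          * (Matrix.of fun a b =>
            fderiv ℝ (fun y => Φ y a) x (Pi.single b 1) : Matrix (Fin 2) (Fin 2) ℝ)⁻¹)
          r c = 0) := by
  classical
  have hD : ∀ x ∈ U, 0 < (L x 0 0 - L x 1 1) ^ 2 + 4 * (L x 0 1 * L x 1 0) := by
    intro x hx
    obtain ⟨a, b, v, w, hab, hv, hw, h1, h2⟩ := hev x hx
    exact aux16_disc (L x) v w a b hab hv hw h1 h2
  obtain ⟨v0, hv0⟩ := aux16_eigfield U hU L hL hD p hp 1 (by norm_num)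
  obtain ⟨v1, hv1⟩ := aux16_eigfield U hU L hL hD p hp (-1) (by norm_num)
  obtain ⟨f0, hf0, u0, hu0⟩ := aux16_first_integral v0 p (hv0.mono fun x hx => hx.1)
    hv0.self_of_nhds.2.1
  obtain ⟨f1, hf1, u1, hu1⟩ := aux16_first_integral v1 p (hv1.mono fun x hx => hx.1)
    hv1.self_of_nhds.2.1
  let Φ : (Fin 2 → ℝ) → (Fin 2 → ℝ) := fun x => ![f0 x, f1 x]
  let J : (Fin 2 → ℝ) → Matrix (Fin 2) (Fin 2) ℝ := fun x =>
    Matrix.of fun a b => fderiv ℝ (fun y => Φ y a) x (Pi.single b 1)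
  have hJ0 : ∀ x w, (J x).mulVec w 0 = fderiv ℝ f0 x w := fun x w => aux16_jac Φ x w 0
  have hJ1 : ∀ x w, (J x).mulVec w 1 = fderiv ℝ f1 x w := fun x w => aux16_jac Φ x w 1
  have hΦs : ∀ᶠ x in nhds p, ContDiffAt ℝ (⊤ : ℕ∞) Φ x := by
    filter_upwards [hf0, hf1] with x h0 h1
    rw [contDiffAt_pi]
    intro i
    fin_cases i
    · exact h0.1
    · exact h1.1
  have hlin : ∀ (f : (Fin 2 → ℝ) → ℝ) (w : Fin 2 → ℝ), fderiv ℝ f p w =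
      fderiv ℝ f p (Pi.single 0 1) * w 0 + fderiv ℝ f p (Pi.single 1 1) * w 1 := by
    intro f w
    have hw : w = w 0 • Pi.single 0 1 + w 1 • Pi.single 1 1 := by
      funext i; fin_cases i <;> simp
    conv_lhs => rw [hw, map_add, map_smul, map_smul]
    simp [mul_comm]
  have hker : ∀ w, fderiv ℝ f0 p w = 0 → fderiv ℝ f1 p w = 0 → w = 0 := by
    intro w hw0 hw1
    by_contra hw
    have hne : ∀ (f : (Fin 2 → ℝ) → ℝ) (u : Fin 2 → ℝ), fderiv ℝ f p u ≠ 0 →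
        fderiv ℝ f p (Pi.single 0 1) ≠ 0 ∨ fderiv ℝ f p (Pi.single 1 1) ≠ 0 := by
      intro f u hu
      by_contra hcon
      push Not at hcon
      apply hu
      rw [hlin, hcon.1, hcon.2]; ring
    have a0 := hf0.self_of_nhds.2
    have a1 := hf1.self_of_nhds.2
    rw [hlin] at hw0 hw1 a0 a1
    have c0 := aux16_cross _ _ _ _ _ _ (hne f0 u0 hu0) a0 hw0
    have c1 := aux16_cross _ _ _ _ _ _ (hne f1 u1 hu1) a1 hw1
    have hw' : w 1 ≠ 0 ∨ - w 0 ≠ 0 := by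
      rcases aux16_ne_zero w hw with h | h
      · right; simpa using h
      · left; exact h
    have c := aux16_cross (w 1) (- w 0) (v0 p 0) (v0 p 1) (v1 p 0) (v1 p 1) hw'
      (by linear_combination c0) (by linear_combination c1)
    refine aux16_eig (L p) (v0 p) (v1 p) _ _ ?_ hv0.self_of_nhds.2.1 hv1.self_of_nhds.2.1
      hv0.self_of_nhds.2.2 hv1.self_of_nhds.2.2 c
    have := Real.sqrt_pos.2 (hD p hp)
    intro h
    linarith
  have hinj : ∀ w, fderiv ℝ Φ p w = 0 → w = 0 := by
    intro w hw
    have hd := (hΦs.self_of_nhds.differentiableAt (by simp)).hasFDerivAt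
    have hd' := hasFDerivAt_pi'.1 hd
    refine hker w ?_ ?_
    · have h := (hd' 0).fderiv
      have h2 : fderiv ℝ f0 p w = (fderiv ℝ Φ p w) 0 := by
        change fderiv ℝ (fun x => Φ x 0) p w = _
        rw [h]; rfl
      rw [h2, hw]; rfl
    · have h := (hd' 1).fderiv
      have h2 : fderiv ℝ f1 p w = (fderiv ℝ Φ p w) 1 := by
        change fderiv ℝ (fun x => Φ x 1) p w = _
        rw [h]; rfl
      rw [h2, hw]; rfl
  obtain ⟨e, hpe, hcoe, hes, -⟩ := aux16_inverse_fin rfl Φ p hΦs hinj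
  have hdet : ∀ᶠ x in nhds p, (J x).det ≠ 0 := by
    have hcont : ContinuousAt (fun x => (J x).det) p := by
      have hc : ∀ (f : (Fin 2 → ℝ) → ℝ) (b : Fin 2), ContDiffAt ℝ (⊤ : ℕ∞) f p →
          ContinuousAt (fun x => fderiv ℝ f x (Pi.single b 1)) p := by
        intro f b hf
        have : ContinuousAt (fderiv ℝ f) p := (hf.fderiv_right (m := 0) (by simp)).continuousAt
        exact this.clm_apply continuousAt_const
      simp only [Matrix.det_fin_two]
      have s0 := hf0.self_of_nhds.1
      have s1 := hf1.self_of_nhds.1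
      exact ((hc f0 0 s0).mul (hc f1 1 s1)).sub ((hc f0 1 s0).mul (hc f1 0 s1))
    apply hcont.eventually_ne
    intro h
    obtain ⟨w, hw, hw2⟩ := Matrix.exists_mulVec_eq_zero_iff.2 h
    apply hw
    apply hker
    · rw [← hJ0, hw2]; rfl
    · rw [← hJ1, hw2]; rfl
  have hUe : ∀ᶠ x in nhds p, x ∈ U := hU.mem_nhds hp
  have hee : ∀ᶠ x in nhds p, x ∈ e.source := e.open_source.mem_nhds hpe
  obtain ⟨V, hVs, hVo, hpV⟩ := _root_.mem_nhds_iff.1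
    ((((hv0.and hv1).and (hf0.and hf1)).and hdet).and (hUe.and hee))
  refine ⟨V, Φ, hVo, hpV, fun x hx => (hVs hx).2.1, ?_, ?_, ?_, ?_⟩
  · intro x hx
    exact (hes x (hVs hx).2.2).contDiffWithinAt
  · intro x hx y hy hxy
    apply e.injOn (hVs hx).2.2 (hVs hy).2.2
    rw [hcoe, hcoe, hxy]
  · intro x hx
    exact isUnit_iff_ne_zero.2 (hVs hx).1.2
  · intro x hx r c hrc
    obtain ⟨⟨⟨⟨-, n0, e0⟩, ⟨-, n1, e1⟩⟩, ⟨-, k0⟩, ⟨-, k1⟩⟩, hdx⟩ := (hVs hx).1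
    have hu : IsUnit (J x).det := isUnit_iff_ne_zero.2 hdx
    have hr : r = 0 ∨ r = 1 := by omega
    rcases hr with rfl | rfl
    · exact aux16_matrix (J x) (L x) hu (v0 x) _ n0 e0 0 c hrc ((hJ0 x _).trans k0)
    · exact aux16_matrix (J x) (L x) hu (v1 x) _ n1 e1 1 c hrc ((hJ1 x _).trans k1)
end

section
/- Main theorem: Let K₁,…,Kₙ be smooth operator fields on an open subset of ℝⁿ that are mutual symmetries (pairwise commuting with vanishing symmetric part of ⟨Kᵢ,Kⱼ⟩). Assume at a point p they are linearly independent (as elements of the space of n×n matrices) and some linear combination Σ cᵢKᵢ has n distinct real eigenvalues at p. Then there exists a local coordinate system near p in which all Kᵢ are given by diagonal matrices. -/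
open Matrix

open Topology Filter
open scoped ContDiff


lemma my_ift {A B : Type*} [NormedAddCommGroup A] [NormedSpace ℝ A] [CompleteSpace A]
    [NormedAddCommGroup B] [NormedSpace ℝ B] [CompleteSpace B]
    (G : A × B → B) (O : Set (A × B)) (hO : IsOpen O) (hG : ContDiffOn ℝ ∞ G O)
    (a0 : A) (b0 : B) (h0 : (a0, b0) ∈ O) (hz : G (a0, b0) = 0)
    (hinv : (fderiv ℝ G (a0, b0) ∘L .inr ℝ A B).IsInvertible) :
    ∃ (W : Set A) (φ : A → B), IsOpen W ∧ a0 ∈ W ∧ φ a0 = b0 ∧ ContDiffOn ℝ ∞ φ W ∧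
      ∀ a ∈ W, (a, φ a) ∈ O ∧ G (a, φ a) = 0 := by
  have hat : ∀ u ∈ O, ContDiffAt ℝ ∞ G u := fun u hu => hG.contDiffAt (hO.mem_nhds hu)
  have n0 : (∞ : WithTop ℕ∞) ≠ 0 := by simp
  have cd0 := hat _ h0
  set φ := cd0.implicitFunction n0 hinv with hφ
  have hcφ : ContDiffAt ℝ ∞ φ a0 := cd0.contDiffAt_implicitFunction n0 hinv
  have hφ0 : φ a0 = b0 := cd0.implicitFunction_apply_self n0 hinv
  have e1 : ∀ᶠ x in 𝓝 a0, G (x, φ x) = 0 := by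
    have := cd0.eventually_apply_implicitFunction n0 hinv
    simpa [hz] using this
  have e2 : ∀ᶠ v in 𝓝 (a0, b0), G v = 0 ↔ φ v.1 = v.2 := by
    have := cd0.eventually_apply_eq_iff_implicitFunction n0 hinv
    simpa only [hz] using this
  have e3 : ∀ᶠ v in 𝓝 (a0, b0), (fderiv ℝ G v ∘L .inr ℝ A B).IsInvertible := by
    have hc : ContinuousAt (fun v => fderiv ℝ G v ∘L .inr ℝ A B) (a0, b0) := by
      have : ContinuousAt (fderiv ℝ G) (a0, b0) :=
        (cd0.fderiv_right (m := 0) (by simp)).continuousAt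
      exact this.clm_comp continuousAt_const
    exact hc.eventually (ContinuousLinearEquiv.isOpen.mem_nhds hinv)
  have e4 : ∀ᶠ v in 𝓝 (a0, b0), v ∈ O := hO.mem_nhds h0
  have hcont : ∀ᶠ x in 𝓝 a0, ContinuousAt φ x := by
    have h1 : ContDiffAt ℝ 1 φ a0 := hcφ.of_le (by exact_mod_cast le_top)
    exact (h1.eventually (by simp)).mono fun x hx => hx.continuousAt
  have ht : Tendsto (fun x => (x, φ x)) (𝓝 a0) (𝓝 (a0, b0)) := by
    have : ContinuousAt (fun x => (x, φ x)) a0 := continuousAt_id.prodMk hcφ.continuousAt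
    simpa [ContinuousAt, hφ0] using this
  have key := e1.and (hcont.and (ht.eventually (e2.eventually_nhds.and (e3.and e4))))
  obtain ⟨W, hW, hWo, haW⟩ := eventually_nhds_iff.1 key
  refine ⟨W, φ, hWo, haW, hφ0, ?_, fun a ha => ?_⟩
  · intro a ha
    obtain ⟨g1, g2, g3, g4, g5⟩ := hW a ha
    apply ContDiffAt.contDiffWithinAt
    have cd1 := hat _ g5
    have hc1 := cd1.contDiffAt_implicitFunction n0 g4
    have hs1 : cd1.implicitFunction n0 g4 a = φ a := cd1.implicitFunction_apply_self n0 g4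
    have f1 : ∀ᶠ x in 𝓝 a, G (x, cd1.implicitFunction n0 g4 x) = 0 := by
      have := cd1.eventually_apply_implicitFunction n0 g4
      simpa [g1] using this
    have ht1 : Tendsto (fun x => (x, cd1.implicitFunction n0 g4 x)) (𝓝 a) (𝓝 (a, φ a)) := by
      have : ContinuousAt (fun x => (x, cd1.implicitFunction n0 g4 x)) a :=
        continuousAt_id.prodMk hc1.continuousAt
      simpa [ContinuousAt, hs1] using this
    refine hc1.congr_of_eventuallyEq ?_
    filter_upwards [f1, ht1.eventually g3] with x h1 h2
    exact h2.1 h1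
  · obtain ⟨g1, g2, g3, g4, g5⟩ := hW a ha
    exact ⟨g5, g1⟩

/-- pointwise application -/
noncomputable def ptApp (I F G : Type) [TopologicalSpace I] [CompactSpace I]
    [NormedAddCommGroup F] [NormedSpace ℝ F] [NormedAddCommGroup G] [NormedSpace ℝ G] :
    C(I, F →L[ℝ] G) →L[ℝ] C(I, F) →L[ℝ] C(I, G) :=
  LinearMap.mkContinuous₂
    (LinearMap.mk₂ ℝ (fun (a : C(I, F →L[ℝ] G)) (u : C(I, F)) =>
      (⟨fun t => a t (u t), by fun_prop⟩ : C(I, G)))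
      (by intros; ext; simp) (by intros; ext; simp) (by intros; ext; simp) (by intros; ext; simp))
    1 (by
      intro a u
      rw [ContinuousMap.norm_le _ (by positivity)]
      intro t
      simp only [LinearMap.mk₂_apply, ContinuousMap.coe_mk, one_mul]
      exact ((a t).le_opNorm _).trans
        (mul_le_mul (a.norm_coe_le_norm t) (u.norm_coe_le_norm t) (norm_nonneg _) (by positivity)))

@[simp] lemma ptApp_apply (I F G : Type) [TopologicalSpace I] [CompactSpace I]
    [NormedAddCommGroup F] [NormedSpace ℝ F] [NormedAddCommGroup G] [NormedSpace ℝ G]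
    (a : C(I, F →L[ℝ] G)) (u : C(I, F)) (t : I) : ptApp I F G a u t = a t (u t) := rfl

lemma nem_deriv (I F G : Type) [TopologicalSpace I] [CompactSpace I]
    [NormedAddCommGroup F] [NormedSpace ℝ F] [NormedAddCommGroup G] [NormedSpace ℝ G]
    (f : C(F, G)) (f' : C(F, F →L[ℝ] G)) (hf : ∀ x, HasFDerivAt f (f' x) x) (u : C(I, F)) :
    HasFDerivAt (fun u : C(I, F) => f.comp u) (ptApp I F G (f'.comp u)) u := by
  rw [hasFDerivAt_iff_isLittleO_nhds_zero, Asymptotics.isLittleO_iff]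
  intro c hc
  -- uniform continuity near the compact image
  have hcomp : IsCompact (Set.range u) := isCompact_range u.continuous
  have huc : ∀ᶠ δ in 𝓝[>] (0:ℝ), ∀ x ∈ Set.range u, ∀ y, dist y x ≤ δ → dist (f' y) (f' x) < c := by
    have hpp := hcomp.uniformContinuousAt_of_continuousAt f' 
      (fun x _ => f'.continuous.continuousAt) (Metric.dist_mem_uniformity hc)
    obtain ⟨ε, hε, h⟩ := Metric.mem_uniformity_dist.1 hpp
    filter_upwards [Ioo_mem_nhdsGT hε] with δ hδ x hx y hy
    have := h (a := x) (b := y) (by rw [dist_comm]; exact lt_of_le_of_lt hy hδ.2) hx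
    rw [dist_comm]; exact this
  obtain ⟨δ, hδ, hδ0⟩ := (huc.and self_mem_nhdsWithin).exists
  replace hδ0 : 0 < δ := hδ0
  filter_upwards [Metric.closedBall_mem_nhds (0 : C(I, F)) hδ0] with h hh
  rw [ContinuousMap.norm_le _ (by positivity)]
  intro t
  have hht : ‖h t‖ ≤ δ := (h.norm_coe_le_norm t).trans (by simpa using hh)
  have hconv : Convex ℝ (Metric.closedBall (u t) δ) := convex_closedBall _ _
  have := hconv.norm_image_sub_le_of_norm_hasFDerivWithin_le' (f := f) (f' := fun x => f' x) (φ := f' (u t)) (C := c)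
    (x := u t) (y := u t + h t)
    (fun x _ => (hf x).hasFDerivWithinAt)
    (fun x hx => by
      rw [← dist_eq_norm]
      exact (hδ _ ⟨t, rfl⟩ x hx).le)
    (by simp [hδ0.le]) (by simpa using hht)
  simp only [add_sub_cancel_left] at this
  refine this.trans ?_
  gcongr
  exact h.norm_coe_le_norm t

lemma nem_contDiff (I F : Type) [TopologicalSpace I] [CompactSpace I]
    [NormedAddCommGroup F] [NormedSpace ℝ F] (n : ℕ) :
    ∀ (G : Type) [NormedAddCommGroup G] [NormedSpace ℝ G] (f : C(F, G)), ContDiff ℝ n f →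
      ContDiff ℝ n (fun u : C(I, F) => f.comp u) := by
  induction n with
  | zero =>
    intro G _ _ f hf
    rw [Nat.cast_zero, contDiff_zero]
    exact ContinuousMap.continuous_postcomp f
  | succ n ih =>
    intro G _ _ f hf
    obtain ⟨f', hf', hd⟩ := contDiff_succ_iff_hasFDerivAt.1 hf
    refine contDiff_succ_iff_hasFDerivAt.2 ⟨fun u => ptApp I F G ((⟨f', hf'.continuous⟩ : C(F, F →L[ℝ] G)).comp u), ?_, ?_⟩
    · exact (ptApp I F G).contDiff.comp (ih _ ⟨f', hf'.continuous⟩ hf')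
    · intro u
      exact nem_deriv I F G f ⟨f', hf'.continuous⟩ hd u

lemma frob_core_aux {E : Type} [NormedAddCommGroup E] [NormedSpace ℝ E]
    (θ : E → E →L[ℝ] ℝ) (hθ : Differentiable ℝ θ) (p e : E) (r : ℝ)
    (hc : Continuous (fderiv ℝ θ))
    (h1 : ∀ q ∈ Metric.ball p r, θ q e = 1)
    (h2 : ∀ q ∈ Metric.ball p r, ∀ v w, θ q v = 0 → θ q w = 0 →
      fderiv ℝ θ q v w = fderiv ℝ θ q w v)
    (x v : E) (u U : ℝ → ℝ) (u0 : u 0 = 0) (U0 : U 0 = 0)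
    (hv : θ (p + x) v = 0)
    (hball : ∀ t ∈ Set.Icc (0:ℝ) 1, p + (1 - t) • x + u t • e ∈ Metric.ball p r)
    (hu : ∀ t ∈ Set.Icc (0:ℝ) 1, HasDerivAt u (θ (p + (1 - t) • x + u t • e) x) t)
    (hU : ∀ t ∈ Set.Icc (0:ℝ) 1, HasDerivAt U
      (fderiv ℝ θ (p + (1 - t) • x + u t • e) ((1 - t) • v + U t • e) x
        + θ (p + (1 - t) • x + u t • e) v) t) :
    U 1 = 0 := by
  set γ : ℝ → E := fun t => p + (1 - t) • x + u t • e with hγ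
  have hγ' : ∀ t ∈ Set.Icc (0:ℝ) 1, HasDerivAt γ (-x + (θ (γ t) x) • e) t := by
    intro t ht
    have a1 : HasDerivAt (fun t : ℝ => (1 - t) • x) (-x) t := by
      simpa using ((hasDerivAt_id t).const_sub 1).smul_const x
    exact (a1.const_add p).add ((hu t ht).smul_const e)
  have hDe : ∀ q ∈ Metric.ball p r, ∀ w, fderiv ℝ θ q w e = 0 := by
    intro q hq w
    have b1 : HasFDerivAt (fun q => θ q e) ((ContinuousLinearMap.apply ℝ ℝ e).comp (fderiv ℝ θ q)) q :=
      (ContinuousLinearMap.apply ℝ ℝ e).hasFDerivAt.comp q (hθ q).hasFDerivAt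
    have b2 : HasFDerivAt (fun q => θ q e) (0 : E →L[ℝ] ℝ) q := by
      refine (hasFDerivAt_const (1:ℝ) q).congr_of_eventuallyEq ?_
      filter_upwards [Metric.isOpen_ball.mem_nhds hq] with y hy using h1 y hy
    have := congrArg (fun L => L w) (b1.unique b2)
    simpa using this
  set g : ℝ → ℝ := fun t => (1 - t) * θ (γ t) v + U t with hg
  have hgd : ∀ t ∈ Set.Icc (0:ℝ) 1, HasDerivAt g (fderiv ℝ θ (γ t) e x * g t) t := by
    intro t ht
    have c1 : HasDerivAt (fun t => θ (γ t)) (fderiv ℝ θ (γ t) (-x + (θ (γ t) x) • e)) t :=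
      (hθ (γ t)).hasFDerivAt.comp_hasDerivAt t (hγ' t ht)
    have c2 : HasDerivAt (fun t => θ (γ t) v) (fderiv ℝ θ (γ t) (-x + (θ (γ t) x) • e) v) t := by
      simpa using c1.clm_apply (hasDerivAt_const t v)
    have c3 := ((((hasDerivAt_id t).const_sub 1).mul c2).add (hU t ht))
    refine c3.congr_deriv ?_
    have hb : γ t ∈ Metric.ball p r := hball t ht
    have hs := h2 (γ t) hb (-x + (θ (γ t) x) • e) ((1 - t) • v + U t • e - g t • e)
      (by simp [h1 _ hb]) (by simp [h1 _ hb, hg])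
    have hγt : p + (1 - t) • x + u t • e = γ t := rfl
    have hgt : g t = (1 - t) * θ (γ t) v + U t := rfl
    rw [hγt]
    simp only [map_add, map_sub, map_neg, map_smul, _root_.add_apply,
      _root_.sub_apply, _root_.neg_apply, _root_.smul_apply,
      smul_eq_mul, hDe _ hb, id] at hs ⊢
    linear_combination hs
  have hgc : ContinuousOn g (Set.Icc 0 1) := fun t ht => (hgd t ht).continuousAt.continuousWithinAt
  have hγc : ContinuousOn γ (Set.Icc 0 1) := fun t ht => (hγ' t ht).continuousAt.continuousWithinAt
  have hkc : ContinuousOn (fun t => fderiv ℝ θ (γ t) e x) (Set.Icc 0 1) := by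
    have := hc.comp_continuousOn hγc
    exact (this.clm_apply continuousOn_const).clm_apply continuousOn_const
  obtain ⟨C, hC⟩ := isCompact_Icc.exists_bound_of_continuousOn hkc
  have g0 : g 0 = 0 := by simp [hg, hγ, u0, U0, hv]
  have hz := eq_zero_of_abs_deriv_le_mul_abs_self_of_eq_zero_right hgc
    (fun t ht => (hgd t ⟨ht.1, ht.2.le⟩).hasDerivWithinAt) g0 (K := C)
    (fun t ht => by
      rw [norm_mul]
      exact mul_le_mul_of_nonneg_right (hC t ⟨ht.1, ht.2.le⟩) (norm_nonneg _))
  have := hz 1 (by simp)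
  simpa [hg] using this


abbrev II := Set.Icc (0:ℝ) 1

/-- primitive -/
noncomputable def prim (h : C(II, ℝ)) (t : ℝ) : ℝ :=
  ∫ s in (0:ℝ)..t, h (Set.projIcc 0 1 zero_le_one s)

lemma prim_hasDerivAt (h : C(II, ℝ)) (t : ℝ) :
    HasDerivAt (prim h) (h (Set.projIcc 0 1 zero_le_one t)) t := by
  have hc : Continuous (fun s : ℝ => h (Set.projIcc 0 1 zero_le_one s)) :=
    h.continuous.comp continuous_projIcc
  exact intervalIntegral.integral_hasDerivAt_right (hc.intervalIntegrable _ _)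
    hc.stronglyMeasurable.stronglyMeasurableAtFilter hc.continuousAt

lemma prim_continuous (h : C(II, ℝ)) : Continuous (prim h) :=
  continuous_iff_continuousAt.2 fun t => (prim_hasDerivAt h t).continuousAt

lemma prim_zero (h : C(II, ℝ)) : prim h 0 = 0 := by simp [prim]

lemma ii_int (h : C(II, ℝ)) (a b : ℝ) : IntervalIntegrable
    (fun s : ℝ => h (Set.projIcc 0 1 zero_le_one s)) MeasureTheory.volume a b :=
  (h.continuous.comp continuous_projIcc).intervalIntegrable _ _

/-- Volterra operator -/
noncomputable def volt : C(II, ℝ) →L[ℝ] C(II, ℝ) :=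
  LinearMap.mkContinuous
    { toFun := fun h => ⟨fun t => prim h t, (prim_continuous h).comp continuous_subtype_val⟩
      map_add' := by
        intro a b; ext t
        exact intervalIntegral.integral_add (ii_int a _ _) (ii_int b _ _)
      map_smul' := by
        intro c a; ext t
        exact intervalIntegral.integral_const_mul _ _ }
    1 (by
      intro h
      rw [ContinuousMap.norm_le _ (by positivity)]
      intro t
      refine (intervalIntegral.norm_integral_le_of_norm_le_const (C := ‖h‖)
        (fun s _ => h.norm_coe_le_norm _)).trans ?_
      rw [mul_comm]
      refine mul_le_mul_of_nonneg_right ?_ (norm_nonneg _)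
      rw [sub_zero, abs_of_nonneg t.2.1]
      exact t.2.2)

lemma volt_apply (h : C(II, ℝ)) (t : II) : volt h t = prim h t := rfl

/-- constants -/
noncomputable def cstL (F : Type) [NormedAddCommGroup F] [NormedSpace ℝ F] : F →L[ℝ] C(II, F) :=
  LinearMap.mkContinuous
    { toFun := fun x => ContinuousMap.const _ x
      map_add' := by intros; ext; simp
      map_smul' := by intros; ext; simp }
    1 (by
      intro h
      rw [ContinuousMap.norm_le _ (by positivity)]
      intro t
      simp)

@[simp] lemma cstL_apply (F : Type) [NormedAddCommGroup F] [NormedSpace ℝ F] (x : F) (t : II) :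
    cstL F x t = x := rfl

/-- the linear part of the curve -/
noncomputable def linC {E : Type} [NormedAddCommGroup E] [NormedSpace ℝ E] (e : E) :
    E × C(II, ℝ) →L[ℝ] C(II, E) :=
  (ptApp II E E ⟨fun t => (1 - (t : ℝ)) • ContinuousLinearMap.id ℝ E, by fun_prop⟩ ∘L cstL E) ∘L
      ContinuousLinearMap.fst ℝ E C(II, ℝ)
    + (ptApp II ℝ E ⟨fun _ => ContinuousLinearMap.toSpanSingleton ℝ e, by fun_prop⟩) ∘L
      ContinuousLinearMap.snd ℝ E C(II, ℝ)

lemma linC_apply {E : Type} [NormedAddCommGroup E] [NormedSpace ℝ E] (e : E) (x : E)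
    (u : C(II, ℝ)) (t : II) : linC e (x, u) t = (1 - (t : ℝ)) • x + u t • e := by
  simp [linC]

lemma bil_comp {X A B C : Type*} [NormedAddCommGroup X] [NormedSpace ℝ X]
    [NormedAddCommGroup A] [NormedSpace ℝ A] [NormedAddCommGroup B] [NormedSpace ℝ B]
    [NormedAddCommGroup C] [NormedSpace ℝ C] (P : A →L[ℝ] B →L[ℝ] C) (N : X → A) (N' : X →L[ℝ] A)
    (z : X) (hN : HasFDerivAt N N' z) : HasFDerivAt (fun z => P (N z)) (P ∘L N') z :=
  P.hasFDerivAt.comp z hN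

lemma frob_core {E : Type} [NormedAddCommGroup E] [NormedSpace ℝ E] [CompleteSpace E]
    (θ : E → E →L[ℝ] ℝ) (hθ : ContDiff ℝ ∞ θ) (p e : E) (r : ℝ) (hr : 0 < r)
    (h1 : ∀ q ∈ Metric.ball p r, θ q e = 1)
    (h2 : ∀ q ∈ Metric.ball p r, ∀ v w, θ q v = 0 → θ q w = 0 →
      fderiv ℝ θ q v w = fderiv ℝ θ q w v) :
    ∃ (W : Set E) (Y : E → ℝ), IsOpen W ∧ p ∈ W ∧ ContDiffOn ℝ ∞ Y W ∧ fderiv ℝ Y p = θ p ∧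
      ∀ q ∈ W, ∀ v, θ q v = 0 → fderiv ℝ Y q v = 0 := by
  have hd : Differentiable ℝ θ := hθ.differentiable (by simp)
  have hc : Continuous (fderiv ℝ θ) := hθ.continuous_fderiv (by simp)
  let θc : C(E, E →L[ℝ] ℝ) := ⟨θ, hθ.continuous⟩
  let θc' : C(E, E →L[ℝ] (E →L[ℝ] ℝ)) := ⟨fderiv ℝ θ, hc⟩
  let cur : E × C(II, ℝ) → C(II, E) := fun z => cstL E p + linC e z
  have hcur : ∀ z, HasFDerivAt cur (linC e) z := fun z => (linC e).hasFDerivAt.const_add _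
  let N : E × C(II, ℝ) → C(II, E →L[ℝ] ℝ) := fun z => θc.comp (cur z)
  let N' : E × C(II, ℝ) → (E × C(II, ℝ) →L[ℝ] C(II, E →L[ℝ] ℝ)) :=
    fun z => ptApp II E (E →L[ℝ] ℝ) (θc'.comp (cur z)) ∘L linC e
  have hN : ∀ z, HasFDerivAt N (N' z) z := fun z =>
    (nem_deriv II E (E →L[ℝ] ℝ) θc θc' (fun x => (hd x).hasFDerivAt) (cur z)).comp z (hcur z)
  have hNs : ContDiff ℝ ∞ N := by
    have a1 : ContDiff ℝ ∞ (fun u : C(II, E) => θc.comp u) :=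
      contDiff_infty.2 fun n => nem_contDiff II E n _ θc (contDiff_infty.1 hθ n)
    exact a1.comp (contDiff_const.add (linC e).contDiff)
  let P := ptApp II E ℝ
  have hP : ContDiff ℝ ∞ (fun a => P a) := by
    apply ContinuousLinearMap.contDiff
  have hPd : ∀ a, HasFDerivAt (fun a => P a) P a := by
    intro a
    apply ContinuousLinearMap.hasFDerivAt
  let G : E × C(II, ℝ) → C(II, ℝ) := fun z => z.2 - volt (P (N z) (cstL E z.1))
  have hGs : ContDiff ℝ ∞ G := by
    have a2 : ContDiff ℝ ∞ (fun z : E × C(II, ℝ) => P (N z) (cstL E z.1)) :=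
      (hP.comp hNs).clm_apply ((cstL E).contDiff.comp contDiff_fst)
    exact contDiff_snd.sub (volt.contDiff.comp a2)
  have hGd : ∀ z v U, fderiv ℝ G z (v, U) =
      U - volt (P (N z) (cstL E v) + P (N' z (v, U)) (cstL E z.1)) := by
    intro z v U
    have b1 : HasFDerivAt (fun z : E × C(II, ℝ) => cstL E z.1)
        (cstL E ∘L ContinuousLinearMap.fst ℝ E C(II, ℝ)) z :=
      (cstL E ∘L ContinuousLinearMap.fst ℝ E C(II, ℝ)).hasFDerivAt
    have b0 : HasFDerivAt (fun z => P (N z)) (P ∘L N' z) z := by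
      exact bil_comp P N (N' z) z (hN z)
    have b2 := b0.clm_apply b1
    have b3 : HasFDerivAt G _ z := (hasFDerivAt_snd (𝕜 := ℝ) (p := z)).sub (volt.hasFDerivAt.comp z b2)
    rw [b3.fderiv]
    simp
  obtain ⟨W0, u, hW0, h0W, hu0, hus, huG⟩ := my_ift G Set.univ isOpen_univ hGs.contDiffOn 0 0
    (Set.mem_univ _) (by simp [G]) (by
      have : (fderiv ℝ G (0, 0) ∘L .inr ℝ E C(II, ℝ)) =
          ((ContinuousLinearEquiv.refl ℝ C(II, ℝ) : C(II, ℝ) ≃L[ℝ] C(II, ℝ)) :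
            C(II, ℝ) →L[ℝ] C(II, ℝ)) := by
        ext1 U
        simp [hGd]
      rw [this]
      exact ContinuousLinearMap.isInvertible_equiv)
  -- integral equation and its linearization
  have hint : ∀ x ∈ W0, u x = volt (P (N (x, u x)) (cstL E x)) := fun x hx => by
    have := (huG x hx).2
    exact sub_eq_zero.1 this
  have hua : ∀ x ∈ W0, ContDiffAt ℝ ∞ u x := fun x hx => hus.contDiffAt (hW0.mem_nhds hx)
  have hlin : ∀ x ∈ W0, ∀ v, fderiv ℝ u x v =
      volt (P (N (x, u x)) (cstL E v) + P (N' (x, u x) (v, fderiv ℝ u x v)) (cstL E x)) := by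
    intro x hx v
    have hdu : HasFDerivAt u (fderiv ℝ u x) x :=
      ((hua x hx).differentiableAt (by simp)).hasFDerivAt
    have c1 : HasFDerivAt (fun x => G (x, u x))
        (fderiv ℝ G (x, u x) ∘L (ContinuousLinearMap.id ℝ E).prod (fderiv ℝ u x)) x :=
      ((hGs.differentiable (by simp)) (x, u x)).hasFDerivAt.comp x ((hasFDerivAt_id x).prodMk hdu)
    have c2 : HasFDerivAt (fun x => G (x, u x)) (0 : E →L[ℝ] C(II, ℝ)) x := by
      refine (hasFDerivAt_const (0 : C(II, ℝ)) x).congr_of_eventuallyEq ?_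
      filter_upwards [hW0.mem_nhds hx] with y hy using (huG y hy).2
    have c3 := congrArg (fun L => L v) (c1.unique c2)
    simp only [ContinuousLinearMap.comp_apply, ContinuousLinearMap.prod_apply, hGd] at c3
    exact sub_eq_zero.1 c3
  -- staying in the ball
  have hst : ∀ᶠ x in 𝓝 (0 : E), ∀ t : II, cur (x, u x) t ∈ Metric.ball p r := by
    have d1 : ContinuousAt (fun x => cur (x, u x)) 0 := by
      have : ContinuousAt (fun x => (x, u x)) (0:E) := continuousAt_id.prodMk (hua 0 h0W).continuousAt
      exact continuousAt_const.add ((linC e).continuous.continuousAt.comp this)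
    have d2 : cur (0, u 0) = cstL E p := by
      simp only [cur, hu0]
      rw [show ((0 : E), (0 : C(II, ℝ))) = 0 from rfl, map_zero, add_zero]
    filter_upwards [d1.eventually (Metric.ball_mem_nhds _ hr)] with x hx t
    rw [d2] at hx
    have := (ContinuousMap.dist_apply_le_dist (f := cur (x, u x)) (g := cstL E p) t)
    exact lt_of_le_of_lt this hx
  obtain ⟨W1, hW1, hW1o, h0W1⟩ := eventually_nhds_iff.1 hst
  let ev : C(II, ℝ) →L[ℝ] ℝ := ContinuousMap.evalCLM ℝ (1 : II)
  have hY : ∀ q, q - p ∈ W0 → HasFDerivAt (fun q => ev (u (q - p))) (ev ∘L fderiv ℝ u (q - p)) q := by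
    intro q hq
    have hdu : HasFDerivAt u (fderiv ℝ u (q - p)) (q - p) :=
      ((hua _ hq).differentiableAt (by simp)).hasFDerivAt
    have := ev.hasFDerivAt.comp q (hdu.comp q ((hasFDerivAt_id q).sub_const p))
    exact this
  refine ⟨(fun q => q - p) ⁻¹' (W0 ∩ W1), fun q => ev (u (q - p)),
    (hW0.inter hW1o).preimage (by fun_prop), by simp [h0W, h0W1], ?_, ?_, ?_⟩
  · refine ev.contDiff.comp_contDiffOn (hus.comp (by fun_prop) fun q hq => hq.1)
  · rw [(hY p (by simpa using h0W)).fderiv]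
    ext v
    rw [sub_self]
    simp only [ContinuousLinearMap.comp_apply]
    rw [hlin 0 h0W v]
    have : P (N (0, u 0)) (cstL E v) + P (N' (0, u 0) (v, fderiv ℝ u 0 v)) (cstL E 0)
        = cstL ℝ (θ p v) := by
      ext t
      simp [P, N, cur, θc, hu0, linC_apply]
    rw [this]
    change prim _ _ = _
    simp [prim]
  · intro q hq v hv
    rw [(hY q hq.1).fderiv]
    set x := q - p with hx
    have hqx : q = p + x := by simp [hx]
    set hh : C(II, ℝ) := P (N (x, u x)) (cstL E x) with hhdef
    set HH : C(II, ℝ) := P (N (x, u x)) (cstL E v) + P (N' (x, u x) (v, fderiv ℝ u x v)) (cstL E x) with HHdef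
    have e1 : u x = volt hh := hint x hq.1
    have e2 : fderiv ℝ u x v = volt HH := hlin x hq.1 v
    have e1t : ∀ t : II, u x t = prim hh t := fun t => by rw [e1]; rfl
    have e2t : ∀ t : II, fderiv ℝ u x v t = prim HH t := fun t => by rw [e2]; rfl
    have hcurt : ∀ t : II, cur (x, u x) t = p + (1 - (t:ℝ)) • x + prim hh t • e := by
      intro t
      simp [cur, linC_apply, e1t, add_assoc]
    have := frob_core_aux θ hd p e r hc h1 h2 x v (prim hh) (prim HH) (prim_zero _) (prim_zero _)
      (by rw [← hqx]; exact hv)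
      (fun t ht => by
        rw [← hcurt ⟨t, ht⟩]; exact hW1 x hq.2 ⟨t, ht⟩)
      (fun t ht => by
        convert prim_hasDerivAt hh t using 1
        rw [Set.projIcc_of_mem _ ht, ← hcurt ⟨t, ht⟩]
        rfl)
      (fun t ht => by
        convert prim_hasDerivAt HH t using 1
        rw [Set.projIcc_of_mem _ ht, ← hcurt ⟨t, ht⟩, add_comm]
        have k : linC e (v, fderiv ℝ u x v) ⟨t, ht⟩ = (1 - t) • v + prim HH t • e := by
          rw [linC_apply, e2t]
        rw [← k]
        rfl)
    change (fderiv ℝ u x v) 1 = 0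
    rw [e2t]
    exact this


lemma frob {E : Type} [NormedAddCommGroup E] [NormedSpace ℝ E] [FiniteDimensional ℝ E]
    (θ : E → E →L[ℝ] ℝ) (O : Set E) (hO : IsOpen O) (hθ : ContDiffOn ℝ ∞ θ O) (p e : E)
    (hp : p ∈ O) (h1 : ∀ q ∈ O, θ q e = 1)
    (h2 : ∀ q ∈ O, ∀ v w, θ q v = 0 → θ q w = 0 →
      fderiv ℝ θ q v w = fderiv ℝ θ q w v) :
    ∃ (W : Set E) (Y : E → ℝ), IsOpen W ∧ p ∈ W ∧ W ⊆ O ∧ ContDiffOn ℝ ∞ Y W ∧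
      fderiv ℝ Y p = θ p ∧ ∀ q ∈ W, ∀ v, θ q v = 0 → fderiv ℝ Y q v = 0 := by
  have : CompleteSpace E := FiniteDimensional.complete ℝ E
  obtain ⟨R, hR, hRO⟩ := Metric.isOpen_iff.1 hO p hp
  let f : ContDiffBump p := ⟨R / 3, R / 2, by positivity, by linarith⟩
  let θ' : E → E →L[ℝ] ℝ := fun q => f q • θ q
  have hθ' : ContDiff ℝ ∞ θ' := by
    rw [contDiff_iff_contDiffAt]
    intro q
    by_cases hq : q ∈ O
    · exact f.contDiffAt.smul (hθ.contDiffAt (hO.mem_nhds hq))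
    · have hq2 : q ∉ Metric.closedBall p (R / 2) := fun h =>
        hq (hRO (Metric.closedBall_subset_ball (by linarith) h))
      have : θ' =ᶠ[𝓝 q] fun _ => 0 := by
        filter_upwards [Metric.isClosed_closedBall.isOpen_compl.mem_nhds hq2] with y hy
        have : f y = 0 := f.zero_of_le_dist (by
          have : ¬ dist y p ≤ R / 2 := hy
          exact le_of_lt (not_le.1 this))
        simp [θ', this]
      exact contDiffAt_const.congr_of_eventuallyEq this
  have heq : ∀ q ∈ Metric.ball p (R / 3), θ' q = θ q := by
    intro q hq
    have : f q = 1 := f.one_of_mem_closedBall (Metric.ball_subset_closedBall hq)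
    simp [θ', this]
  have hsub : Metric.ball p (R / 3) ⊆ O := (Metric.ball_subset_ball (by linarith)).trans hRO
  have heq' : ∀ q ∈ Metric.ball p (R / 3), fderiv ℝ θ' q = fderiv ℝ θ q := by
    intro q hq
    apply Filter.EventuallyEq.fderiv_eq
    filter_upwards [Metric.isOpen_ball.mem_nhds hq] with y hy using heq y hy
  obtain ⟨W, Y, hW, hpW, hY, hYp, hYv⟩ := frob_core θ' hθ' p e (R / 3) (by positivity)
    (fun q hq => by rw [heq q hq]; exact h1 q (hsub hq))
    (fun q hq v w => by rw [heq q hq, heq' q hq]; exact h2 q (hsub hq) v w)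
  have hpb : p ∈ Metric.ball p (R / 3) := Metric.mem_ball_self (by positivity)
  refine ⟨W ∩ Metric.ball p (R / 3), Y, hW.inter Metric.isOpen_ball, ⟨hpW, hpb⟩,
    fun q hq => hsub hq.2, hY.mono fun q hq => hq.1, by rw [hYp, heq p hpb], ?_⟩
  intro q hq v hv
  exact hYv q hq.1 v (by rw [heq q hq.2]; exact hv)

lemma eig_smooth {E ι : Type} [NormedAddCommGroup E] [NormedSpace ℝ E] [FiniteDimensional ℝ E]
    [Fintype ι] [DecidableEq ι]
    (L : E → E →L[ℝ] E) (O : Set E) (hO : IsOpen O) (hL : ContDiffOn ℝ ∞ L O) (p : E)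
    (hp : p ∈ O) (b : Module.Basis ι ℝ E) (lam : ι → ℝ) (hlam : Function.Injective lam)
    (hb : ∀ k, L p (b k) = lam k • b k) (c : ι) :
    ∃ (W : Set E) (θ : E → E →L[ℝ] ℝ) (l : E → ℝ), IsOpen W ∧ p ∈ W ∧ W ⊆ O ∧
      ContDiffOn ℝ ∞ θ W ∧ ContDiffOn ℝ ∞ l W ∧ (∀ v, θ p v = b.repr v c) ∧ l p = lam c ∧
      ∀ q ∈ W, θ q ∘L L q = l q • θ q ∧ θ q (b c) = 1 := by
  have : CompleteSpace E := FiniteDimensional.complete ℝ E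
  let θ0 : E →L[ℝ] ℝ := (b.coord c).toContinuousLinearMap
  have hθ0 : ∀ v, θ0 v = b.repr v c := fun v => rfl
  have hbc : ∀ k, θ0 (b k) = if k = c then 1 else 0 := by
    intro k; rw [hθ0]; simp [Finsupp.single_apply]
  have hθL : θ0 ∘L L p = lam c • θ0 := by
    apply ContinuousLinearMap.coe_injective
    apply b.ext
    intro k
    simp only [ContinuousLinearMap.coe_coe, ContinuousLinearMap.comp_apply, hb, map_smul, hbc,
      _root_.smul_apply, smul_eq_mul]
    split_ifs with h <;> simp [h]
  let G : E × ((E →L[ℝ] ℝ) × ℝ) → (E →L[ℝ] ℝ) × ℝ :=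
    fun z => (z.2.1 ∘L L z.1 - z.2.2 • z.2.1, z.2.1 (b c) - 1)
  have hGs : ContDiffOn ℝ ∞ G (O ×ˢ Set.univ) := by
    have a1 : ContDiffOn ℝ ∞ (fun z : E × ((E →L[ℝ] ℝ) × ℝ) => L z.1) (O ×ˢ Set.univ) :=
      hL.comp contDiff_fst.contDiffOn fun z hz => hz.1
    have a2 : ContDiff ℝ ∞ (fun z : E × ((E →L[ℝ] ℝ) × ℝ) => z.2.1) :=
      contDiff_fst.comp contDiff_snd
    have a3 : ContDiff ℝ ∞ (fun z : E × ((E →L[ℝ] ℝ) × ℝ) => z.2.2) :=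
      contDiff_snd.comp contDiff_snd
    exact ((a2.contDiffOn.clm_comp a1).sub (a3.smul a2).contDiffOn).prodMk
      ((a2.clm_apply contDiff_const).sub contDiff_const).contDiffOn
  have hmem : (p, (θ0, lam c)) ∈ O ×ˢ (Set.univ : Set ((E →L[ℝ] ℝ) × ℝ)) := ⟨hp, Set.mem_univ _⟩
  have hOo : IsOpen (O ×ˢ (Set.univ : Set ((E →L[ℝ] ℝ) × ℝ))) := hO.prod isOpen_univ
  have hD : ∀ w s, (fderiv ℝ G (p, (θ0, lam c)) ∘L .inr ℝ E ((E →L[ℝ] ℝ) × ℝ)) (w, s) =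
      (w ∘L L p - (lam c • w + s • θ0), w (b c)) := by
    intro w s
    have d1 : HasFDerivAt G (fderiv ℝ G (p, (θ0, lam c))) (p, (θ0, lam c)) :=
      ((hGs.contDiffAt (hOo.mem_nhds hmem)).differentiableAt (by simp)).hasFDerivAt
    have d2 : HasFDerivAt (fun y : (E →L[ℝ] ℝ) × ℝ => G (p, y)) 
        (fderiv ℝ G (p, (θ0, lam c)) ∘L .inr ℝ E ((E →L[ℝ] ℝ) × ℝ)) (θ0, lam c) :=
      HasFDerivAt.comp (θ0, lam c) d1 (hasFDerivAt_prodMk_right p (θ0, lam c))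
    have e1 : HasFDerivAt (fun y : (E →L[ℝ] ℝ) × ℝ => y.1) _ (θ0, lam c) := hasFDerivAt_fst (𝕜 := ℝ)
    have e2 : HasFDerivAt (fun y : (E →L[ℝ] ℝ) × ℝ => y.2) _ (θ0, lam c) := hasFDerivAt_snd (𝕜 := ℝ)
    have d3 := ((e1.clm_comp (hasFDerivAt_const (L p) _)).sub (e2.smul e1)).prodMk
      ((e1.clm_apply (hasFDerivAt_const (b c) _)).sub_const 1)
    have := d2.unique d3
    rw [this]
    ext <;> simp
  obtain ⟨W, φ, hW, hpW, hφ0, hφ, hφG⟩ := my_ift G (O ×ˢ Set.univ) hOo hGs p (θ0, lam c) hmem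
    (by ext <;> simp [G, hθL, hbc]) (by
      set D := (fderiv ℝ G (p, (θ0, lam c)) ∘L .inr ℝ E ((E →L[ℝ] ℝ) × ℝ)) with hDdef
      have hinj : Function.Injective (D : ((E →L[ℝ] ℝ) × ℝ) →ₗ[ℝ] ((E →L[ℝ] ℝ) × ℝ)) := by
        rw [← LinearMap.ker_eq_bot, LinearMap.ker_eq_bot']
        rintro ⟨w, s⟩ h
        rw [ContinuousLinearMap.coe_coe, hD, Prod.mk_eq_zero] at h
        obtain ⟨h1, h2⟩ := h
        have h3 : ∀ k, lam k * w (b k) - (lam c * w (b k) + s * θ0 (b k)) = 0 := by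
          intro k
          have := congrArg (fun f => f (b k)) h1
          simpa [hb] using this
        have hs : s = 0 := by
          have := h3 c
          simp [hbc] at this
          exact this
        have hw : w = 0 := by
          apply ContinuousLinearMap.coe_injective
          apply b.ext
          intro k
          by_cases hk : k = c
          · simp [hk, h2]
          · have := h3 k
            rw [hs] at this
            have h4 : (lam k - lam c) * w (b k) = 0 := by linarith
            rcases mul_eq_zero.1 h4 with h5 | h5
            · exact absurd (hlam (sub_eq_zero.1 h5)) hk
            · simpa using h5
        simp [hs, hw]
      refine ⟨(LinearEquiv.ofInjectiveEndo _ hinj).toContinuousLinearEquiv, ?_⟩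
      exact ContinuousLinearMap.ext fun x => rfl)
  refine ⟨W, fun q => (φ q).1, fun q => (φ q).2, hW, hpW, fun q hq => (hφG q hq).1.1,
    contDiff_fst.comp_contDiffOn hφ, contDiff_snd.comp_contDiffOn hφ, ?_, ?_, ?_⟩
  · intro v; simp only [hφ0]; rfl
  · simp only [hφ0]
  · intro q hq
    have := (hφG q hq).2
    rw [Prod.ext_iff] at this
    exact ⟨sub_eq_zero.1 this.1, sub_eq_zero.1 this.2⟩

/-- differentiate the eigen-relation -/
lemma diff_eig {E : Type} [NormedAddCommGroup E] [NormedSpace ℝ E]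
    (K : E → E →L[ℝ] E) (θ : E → E →L[ℝ] ℝ) (q : E) (hK : DifferentiableAt ℝ K q)
    (hθ : DifferentiableAt ℝ θ q) (h : ∀ᶠ x in 𝓝 q, ∃ s : ℝ, θ x ∘L K x = s • θ x)
    (w w0 : E) (la lc : ℝ) (hw : K q w = la • w) (hw0 : K q w0 = lc • w0)
    (ht : θ q w = 0) (ht0 : θ q w0 = 1) (v : E) :
    θ q (fderiv ℝ K q v w) = (lc - la) * fderiv ℝ θ q v w := by
  have dK := hK.hasFDerivAt
  have dθ := hθ.hasFDerivAt
  have f1 : ∀ w, HasFDerivAt (fun x => θ x w) _ q := fun w =>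
    dθ.clm_apply (hasFDerivAt_const w q)
  have f2 : ∀ w, HasFDerivAt (fun x => θ x (K x w)) _ q := fun w =>
    dθ.clm_apply (dK.clm_apply (hasFDerivAt_const w q))
  have g1 := ((f2 w).mul (f1 w0)).sub ((f2 w0).mul (f1 w))
  have g2 := (hasFDerivAt_const (𝕜 := ℝ) (0 : ℝ) q).congr_of_eventuallyEq
    (f₁ := fun x => θ x (K x w) * θ x w0 - θ x (K x w0) * θ x w) (by
      filter_upwards [h] with x ⟨s, hs⟩
      have hs' : ∀ y, θ x (K x y) = s * θ x y := fun y => by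
        have := congrArg (fun f => f y) hs
        simpa using this
      rw [hs', hs']; ring)
  have := congrArg (fun f => f v) (g1.unique g2)
  simp [hw, hw0, ht, ht0] at this
  linarith

lemma integ {E ι : Type} [NormedAddCommGroup E] [NormedSpace ℝ E]
    (K M : E → E →L[ℝ] E) (θ : E → E →L[ℝ] ℝ) (q : E) (hK : DifferentiableAt ℝ K q)
    (hM : DifferentiableAt ℝ M q)
    (hθ : DifferentiableAt ℝ θ q) (h : ∀ᶠ x in 𝓝 q, ∃ s : ℝ, θ x ∘L K x = s • θ x)
    (h' : ∀ᶠ x in 𝓝 q, ∃ s : ℝ, θ x ∘L M x = s • θ x)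
    (v : ι → E) (l m : ι → ℝ) (hl : ∀ a, K q (v a) = l a • v a) (hm : ∀ a, M q (v a) = m a • v a)
    (c : ι) (htc : θ q (v c) = 1) (hlc : ∀ x, θ q (K q x) = l c * θ q x)
    (hmc : ∀ x, θ q (M q x) = m c * θ q x)
    (hS : ∀ x, - M q (fderiv ℝ K q x x) + K q (fderiv ℝ M q x x) - fderiv ℝ M q (K q x) x
      + fderiv ℝ K q (M q x) x = 0) (a b : ι) (ha : θ q (v a) = 0) (hb : θ q (v b) = 0) :
    ((l c - l a) * (m c - m b) - (l c - l b) * (m c - m a)) *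
      (fderiv ℝ θ q (v a) (v b) - fderiv ℝ θ q (v b) (v a)) = 0 := by
  have hKd : ∀ a, θ q (v a) = 0 → ∀ x, θ q (fderiv ℝ K q x (v a)) = _ := fun a ha x =>
    diff_eig K θ q hK hθ h (v a) (v c) (l a) (l c) (hl a) (hl c) ha htc x
  have hMd : ∀ a, θ q (v a) = 0 → ∀ x, θ q (fderiv ℝ M q x (v a)) = _ := fun a ha x =>
    diff_eig M θ q hM hθ h' (v a) (v c) (m a) (m c) (hm a) (hm c) ha htc x
  have e1 := congrArg (θ q) (hS (v a))
  have e2 := congrArg (θ q) (hS (v b))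
  have e3 := congrArg (θ q) (hS (v a + v b))
  simp only [map_add, map_sub, map_neg, map_zero, map_smul, _root_.add_apply, _root_.smul_apply, hl, hm, hlc, hmc,
    hKd a ha, hKd b hb, hMd a ha, hMd b hb, smul_eq_mul] at e1 e2 e3
  linear_combination e3 - e1 - e2

lemma coeff_zero {ι : Type} [Fintype ι] [DecidableEq ι] (l : ι → ι → ℝ) (hl : LinearIndependent ℝ l)
    (a b c : ι) (hab : a ≠ b) (hac : a ≠ c) (hbc : b ≠ c) (T : ℝ)
    (h : ∀ i j, ((l i c - l i a) * (l j c - l j b) - (l i c - l i b) * (l j c - l j a)) * T = 0) :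
    T = 0 := by
  have hs : Submodule.span ℝ (Set.range l) = ⊤ := by
    apply hl.span_eq_top_of_card_eq_finrank'
    simp
  by_contra hT
  have h0 : ∀ i j, (l i c - l i a) * (l j c - l j b) - (l i c - l i b) * (l j c - l j a) = 0 :=
    fun i j => (mul_eq_zero.1 (h i j)).resolve_right hT
  have h1 : ∀ (x : ι → ℝ) (j : ι), (x c - x a) * (l j c - l j b) - (x c - x b) * (l j c - l j a) = 0 := by
    intro x j
    have hx : x ∈ Submodule.span ℝ (Set.range l) := hs ▸ Submodule.mem_top
    induction hx using Submodule.span_induction with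
    | mem x h => obtain ⟨i, rfl⟩ := h; exact h0 i j
    | zero => simp
    | add x y _ _ hx hy => simp only [Pi.add_apply]; linear_combination hx + hy
    | smul r x _ hx => simp only [Pi.smul_apply, smul_eq_mul]; linear_combination r * hx
  have h2 : ∀ x y : ι → ℝ, (x c - x a) * (y c - y b) - (x c - x b) * (y c - y a) = 0 := by
    intro x y
    have hy : y ∈ Submodule.span ℝ (Set.range l) := hs ▸ Submodule.mem_top
    induction hy using Submodule.span_induction with
    | mem y h => obtain ⟨i, rfl⟩ := h; exact h1 x i
    | zero => simp
    | add y z _ _ hx hy => simp only [Pi.add_apply]; linear_combination hx + hy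
    | smul r y _ hx => simp only [Pi.smul_apply, smul_eq_mul]; linear_combination r * hx
  have := h2 (Pi.single a 1) (Pi.single b 1)
  simp [Pi.single_apply, hab, hab.symm, hac.symm, hbc.symm] at this


lemma main_abs {E ι : Type} [NormedAddCommGroup E] [NormedSpace ℝ E] [FiniteDimensional ℝ E]
    [Fintype ι] [DecidableEq ι]
    (K : ι → E → E →L[ℝ] E) (U : Set E) (hU : IsOpen U) (hK : ∀ i, ContDiffOn ℝ ∞ (K i) U)
    (hcomm : ∀ i j, ∀ x ∈ U, K i x ∘L K j x = K j x ∘L K i x)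
    (hS : ∀ i j, ∀ q ∈ U, ∀ x, - K j q (fderiv ℝ (K i) q x x) + K i q (fderiv ℝ (K j) q x x)
      - fderiv ℝ (K j) q (K i q x) x + fderiv ℝ (K i) q (K j q x) x = 0)
    (p : E) (hp : p ∈ U) (hind : LinearIndependent ℝ (fun i => K i p))
    (c : ι → ℝ) (b : Module.Basis ι ℝ E) (lam : ι → ℝ) (hlam : Function.Injective lam)
    (hb : ∀ k, (∑ i, c i • K i p) (b k) = lam k • b k) :
    ∃ (V : Set E) (Y : ι → E → ℝ), IsOpen V ∧ p ∈ V ∧ V ⊆ U ∧ (∀ a, ContDiffOn ℝ ∞ (Y a) V) ∧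
      (∀ a v, fderiv ℝ (Y a) p v = b.repr v a) ∧
      ∀ q ∈ V, ∀ i a, ∃ s : ℝ, fderiv ℝ (Y a) q ∘L K i q = s • fderiv ℝ (Y a) q := by
  let L : E → E →L[ℝ] E := fun q => ∑ i, c i • K i q
  have hL : ContDiffOn ℝ ∞ L U := by
    apply ContDiffOn.sum
    intro i _
    exact (hK i).const_smul (c i)
  choose W θ l hWo hpW hWU hθ hl hθp hlp hθW using
    fun a => eig_smooth L U hU hL p hp b lam hlam hb a
  have hθc : ∀ a, ContinuousAt (θ a) p := fun a =>
    ((hθ a).contDiffAt ((hWo a).mem_nhds (hpW a))).continuousAt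
  have hlc : ∀ a, ContinuousAt (l a) p := fun a =>
    ((hl a).contDiffAt ((hWo a).mem_nhds (hpW a))).continuousAt
  -- good points
  have E1 : ∀ᶠ q in 𝓝 p, q ∈ U ∧ ∀ a, q ∈ W a :=
    (hU.eventually_mem hp).and (eventually_all.2 fun a => (hWo a).mem_nhds (hpW a))
  have E2 : ∀ᶠ q in 𝓝 p, ∀ a a', a ≠ a' → l a q ≠ l a' q := by
    refine eventually_all.2 fun a => eventually_all.2 fun a' => ?_
    by_cases h : a = a'
    · simp [h]
    · have : ∀ᶠ q in 𝓝 p, l a q ≠ l a' q := by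
        have := ((hlc a).sub (hlc a')).eventually_ne (y := 0) (by
          rw [Pi.sub_apply, hlp, hlp]; exact sub_ne_zero.2 fun h' => h (hlam h'))
        filter_upwards [this] with q hq using sub_ne_zero.1 hq
      filter_upwards [this] with q hq _ using hq
  have E3 : ∀ᶠ q in 𝓝 p, LinearIndependent ℝ (fun i => K i q) := by
    have h1 : ContinuousAt (fun q => fun i => K i q) p := continuousAt_pi.2 fun i =>
      ((hK i).contDiffAt (hU.mem_nhds hp)).continuousAt
    exact h1.eventually (isOpen_setOfPred_linearIndependent.mem_nhds hind)
  have E4 : ∀ᶠ q in 𝓝 p, ∃ v : Module.Basis ι ℝ E, ∀ a x, θ a q x = v.repr x a := by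
    let T : E → E →L[ℝ] (ι → ℝ) := fun q => ContinuousLinearMap.pi fun a => θ a q
    have h1 : ContinuousAt T p := by
      have h0 : ContinuousAt (fun q a => θ a q) p := continuousAt_pi.2 hθc
      exact (ContinuousLinearMap.piEquivL ℝ E (fun _ : ι => ℝ)).continuous.continuousAt.comp h0
    have h2 : T p = (b.equivFunL : E →L[ℝ] ι → ℝ) := by
      ext x a
      simp [T, hθp]
    have h3 := h1.tendsto (by rw [h2]; exact ContinuousLinearEquiv.nhds b.equivFunL)
    filter_upwards [h3] with q ⟨e, he⟩
    refine ⟨Module.Basis.ofEquivFun e.toLinearEquiv, fun a x => ?_⟩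
    have : e x = T q x := by rw [← he]; rfl
    have h4 := congrFun this a
    simp [T] at h4
    simp [← h4]
  obtain ⟨O, hO, hOo, hpO⟩ := eventually_nhds_iff.1 (E1.and (E2.and (E3.and E4)))
  -- eigen-covectors of all operators
  have hOU : ∀ q ∈ O, q ∈ U := fun q hq => by
    exact (hO q hq).1.1
  have hKL : ∀ q ∈ U, ∀ i, K i q ∘L L q = L q ∘L K i q := by
    intro q hq i
    ext x
    simp only [L, ContinuousLinearMap.comp_apply, _root_.sum_apply, _root_.smul_apply,
      map_sum, map_smul]
    refine Finset.sum_congr rfl fun j _ => ?_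
    have := congrArg (fun f => f x) (hcomm i j q hq)
    simp only [ContinuousLinearMap.comp_apply] at this
    rw [this]
  have key : ∀ q ∈ O, ∃ (v : Module.Basis ι ℝ E) (s : ι → ι → ℝ), (∀ a x, θ a q x = v.repr x a) ∧
      (∀ i a, K i q (v a) = s i a • v a) ∧ (∀ i a x, θ a q (K i q x) = s i a * θ a q x) ∧
      LinearIndependent ℝ s := by
    intro q hq
    obtain ⟨⟨-, hqW⟩, hdist, hli, v, hv⟩ := hO q hq
    have hvv : ∀ a a', θ a q (v a') = if a' = a then 1 else 0 := by
      intro a a'; rw [hv]; simp [Finsupp.single_apply]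
    have hθL : ∀ a x, θ a q (L q x) = l a q * θ a q x := fun a x => by
      have := congrArg (fun f => f x) (hθW a q (hqW a)).1
      simpa using this
    have hLv : ∀ a, L q (v a) = l a q • v a := by
      intro a
      apply v.ext_elem
      intro a'
      rw [← hv, ← hv, hθL, map_smul, hvv, smul_eq_mul]
      split_ifs with h
      · rw [h]
      · simp
    have hz : ∀ i a a', a' ≠ a → θ a q (K i q (v a')) = 0 := by
      intro i a a' h
      have h1 := congrArg (fun f => θ a q (f (v a'))) (hKL q (hOU q hq) i)
      simp only [ContinuousLinearMap.comp_apply, hLv, hθL, map_smul, smul_eq_mul] at h1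
      have h2 : (l a' q - l a q) * θ a q (K i q (v a')) = 0 := by linarith
      exact (mul_eq_zero.1 h2).resolve_left (sub_ne_zero.2 (hdist _ _ h))
    have hKv : ∀ i a, K i q (v a) = θ a q (K i q (v a)) • v a := by
      intro i a
      apply v.ext_elem
      intro a'
      rw [← hv, ← hv, map_smul, hvv, smul_eq_mul]
      split_ifs with h
      · rw [h]; simp
      · rw [hz i a' a h]; simp
    refine ⟨v, fun i a => θ a q (K i q (v a)), hv, hKv, ?_, ?_⟩
    · intro i a x
      have : (θ a q ∘L K i q : E →ₗ[ℝ] ℝ) = (θ a q (K i q (v a)) • θ a q : E →L[ℝ] ℝ) := by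
        apply v.ext
        intro a'
        by_cases h : a' = a
        · simp [h, hvv]
        · simp [hz i a a' h, hvv, h]
      have := congrArg (fun f => f x) this
      simpa using this
    · rw [Fintype.linearIndependent_iff] at hli ⊢
      intro g hg
      apply hli g
      apply ContinuousLinearMap.coe_injective
      apply v.ext
      intro a
      have h1 := congrFun hg a
      simp only [Finset.sum_apply, Pi.smul_apply, smul_eq_mul, Pi.zero_apply] at h1
      simp only [ContinuousLinearMap.coe_coe, _root_.sum_apply, _root_.smul_apply]
      rw [Finset.sum_congr rfl fun i _ => by rw [hKv i a, smul_smul], ← Finset.sum_smul, h1]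
      simp
  -- integrability
  have hint : ∀ a, ∀ q ∈ O, ∀ x y, θ a q x = 0 → θ a q y = 0 →
      fderiv ℝ (θ a) q x y = fderiv ℝ (θ a) q y x := by
    intro a q hq x y hx hy
    obtain ⟨v, s, hv, hKv, hθK, hs⟩ := key q hq
    have hvv : ∀ a a', θ a q (v a') = if a' = a then 1 else 0 := by
      intro a a'; rw [hv]; simp [Finsupp.single_apply]
    have hdK : ∀ i, DifferentiableAt ℝ (K i) q := fun i =>
      ((hK i).contDiffAt (hU.mem_nhds (hOU q hq))).differentiableAt (by simp)
    have hdθ : DifferentiableAt ℝ (θ a) q :=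
      ((hθ a).contDiffAt ((hWo a).mem_nhds ((hO q hq).1.2 a))).differentiableAt (by simp)
    have hev : ∀ i, ∀ᶠ x in 𝓝 q, ∃ s : ℝ, θ a x ∘L K i x = s • θ a x := by
      intro i
      filter_upwards [hOo.mem_nhds hq] with x hx
      obtain ⟨v, s, hv, hKv, hθK, hs⟩ := key x hx
      exact ⟨s i a, by ext y; simp [hθK]⟩
    have hT : ∀ d e, d ≠ a → e ≠ a →
        fderiv ℝ (θ a) q (v d) (v e) - fderiv ℝ (θ a) q (v e) (v d) = 0 := by
      intro d e hd he
      by_cases hde : d = e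
      · simp [hde]
      refine coeff_zero s hs d e a hde hd he _ fun i j => ?_
      exact integ (K i) (K j) (θ a) q (hdK i) (hdK j) hdθ (hev i) (hev j) v (s i) (s j)
        (hKv i) (hKv j) a (by simp [hvv]) (hθK i a) (hθK j a) (hS i j q (hOU q hq)) d e
        (by simp [hvv, hd]) (by simp [hvv, he])
    rw [hv] at hx hy
    have hB : ∀ x y, fderiv ℝ (θ a) q x y =
        ∑ d, ∑ e, v.repr x d * v.repr y e * fderiv ℝ (θ a) q (v d) (v e) := by
      intro x y
      conv_lhs => rw [← v.sum_repr x, ← v.sum_repr y]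
      simp only [map_sum, map_smul, _root_.sum_apply, _root_.smul_apply, smul_eq_mul,
        Finset.mul_sum]
      rw [Finset.sum_comm]
      exact Finset.sum_congr rfl fun _ _ => Finset.sum_congr rfl fun _ _ => by ring
    rw [hB x y, hB y x, Finset.sum_comm]
    refine Finset.sum_congr rfl fun e _ => Finset.sum_congr rfl fun d _ => ?_
    by_cases hd : d = a
    · simp [hd, hx]
    by_cases he : e = a
    · simp [he, hy]
    have := hT d e hd he
    linear_combination (v.repr x d * v.repr y e) * this
  choose W' Y hW'o hpW' hW'O hY hYp hYq using fun a =>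
    frob (θ a) O hOo ((hθ a).mono fun q hq => (hO q hq).1.2 a) p (b a) hpO
      (fun q hq => (hθW a q ((hO q hq).1.2 a)).2) (hint a)
  refine ⟨O ∩ ⋂ a, W' a, Y, hOo.inter (isOpen_iInter_of_finite hW'o),
    ⟨hpO, Set.mem_iInter.2 hpW'⟩, fun q hq => hOU q hq.1,
    fun a => (hY a).mono fun q hq => Set.mem_iInter.1 hq.2 a,
    fun a v => by rw [hYp, hθp], ?_⟩
  intro q hq i a
  obtain ⟨v, s, hv, hKv, hθK, hs⟩ := key q hq.1
  have hone := (hθW a q ((hO q hq.1).1.2 a)).2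
  have hprop : ∀ x, fderiv ℝ (Y a) q x = θ a q x * fderiv ℝ (Y a) q (b a) := by
    intro x
    have := hYq a q (Set.mem_iInter.1 hq.2 a) (x - θ a q x • b a) (by simp [hone])
    simp only [map_sub, map_smul, smul_eq_mul] at this
    linarith
  refine ⟨s i a, ?_⟩
  ext x
  rw [ContinuousLinearMap.comp_apply, _root_.smul_apply, hprop, hprop x, hθK, smul_eq_mul, mul_assoc]

lemma jac_apply {n : ℕ} (f : (Fin n → ℝ) →L[ℝ] ℝ) (x : Fin n → ℝ) :
    f x = ∑ c, f (Pi.single c 1) * x c := by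
  conv_lhs => rw [← Finset.univ_sum_single x]
  rw [map_sum]
  refine Finset.sum_congr rfl fun c _ => ?_
  have : (Pi.single c (x c) : Fin n → ℝ) = x c • Pi.single c 1 := by
    rw [← Pi.single_smul]; simp
  rw [this, map_smul, smul_eq_mul, mul_comm]


theorem stmt17 {n : ℕ} (U : Set (Fin n → ℝ)) (hU : IsOpen U)
    (K : Fin n → (Fin n → ℝ) → Matrix (Fin n) (Fin n) ℝ)
    (hK : ∀ i r c, ContDiffOn ℝ (⊤ : ℕ∞) (fun x => K i x r c) U)
    (hcomm : ∀ i j, ∀ x ∈ U, K i x * K j x = K j x * K i x)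
    (hsym : ∀ i j, ∀ ξ : (Fin n → ℝ) → (Fin n → ℝ), ContDiff ℝ (⊤ : ℕ∞) ξ →
      ∀ x ∈ U, nijBr (K i) (K j) ξ ξ x = 0)
    (p : Fin n → ℝ) (hp : p ∈ U)
    (hind : LinearIndependent ℝ (fun i => K i p))
    (hev : ∃ c : Fin n → ℝ, ∃ lam : Fin n → ℝ, Function.Injective lam ∧
      ∀ k, ∃ w : Fin n → ℝ, w ≠ 0 ∧ (∑ i, c i • K i p).mulVec w = lam k • w) :
    ∃ (V : Set (Fin n → ℝ)) (Φ : (Fin n → ℝ) → (Fin n → ℝ)),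
      IsOpen V ∧ p ∈ V ∧ V ⊆ U ∧
      ContDiffOn ℝ (⊤ : ℕ∞) Φ V ∧ Set.InjOn Φ V ∧
      (∀ x ∈ V, IsUnit (Matrix.of fun r c =>
        fderiv ℝ (fun y => Φ y r) x (Pi.single c 1) : Matrix (Fin n) (Fin n) ℝ).det) ∧
      (∀ x ∈ V, ∀ i, ∀ r c : Fin n, r ≠ c →
        ((Matrix.of fun a b =>
            fderiv ℝ (fun y => Φ y a) x (Pi.single b 1) : Matrix (Fin n) (Fin n) ℝ)
          * K i x
          * (Matrix.of fun a b =>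
            fderiv ℝ (fun y => Φ y a) x (Pi.single b 1) : Matrix (Fin n) (Fin n) ℝ)⁻¹)
          r c = 0) := by
  obtain ⟨c, lam, hlam, hw⟩ := hev
  choose w hw0 hw using hw
  let toC : Matrix (Fin n) (Fin n) ℝ →ₗ[ℝ] ((Fin n → ℝ) →L[ℝ] (Fin n → ℝ)) :=
    (LinearMap.toContinuousLinearMap : ((Fin n → ℝ) →ₗ[ℝ] (Fin n → ℝ)) ≃ₗ[ℝ] _).toLinearMap ∘ₗ
      (Matrix.toLin' : Matrix (Fin n) (Fin n) ℝ ≃ₗ[ℝ] _).toLinearMap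
  have htoC : ∀ A x, toC A x = A.mulVec x := fun A x => by simp [toC]
  have htoCi : Function.Injective toC := by
    simp only [toC, LinearMap.coe_comp, LinearEquiv.coe_coe]
    exact (LinearEquiv.injective _).comp (LinearEquiv.injective _)
  let Kc : Fin n → (Fin n → ℝ) → (Fin n → ℝ) →L[ℝ] (Fin n → ℝ) := fun i q => toC (K i q)
  have hKc : ∀ i q x, Kc i q x = (K i q).mulVec x := fun i q x => htoC _ _
  have hKs : ∀ i, ContDiffOn ℝ ∞ (Kc i) U := by
    intro i
    rw [contDiffOn_clm_apply]
    intro x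
    rw [contDiffOn_pi]
    intro r
    simp only [hKc, Matrix.mulVec, dotProduct]
    exact ContDiffOn.sum fun k _ => (hK i r k).mul contDiffOn_const
  have hLw : ∀ k, (∑ i, c i • Kc i p) (w k) = lam k • w k := by
    intro k
    rw [← hw k, ← htoC, map_sum]
    simp [Kc]
  have hwli : LinearIndependent ℝ w := by
    refine Module.End.eigenvectors_linearIndependent' 
      ((∑ i, c i • Kc i p : (Fin n → ℝ) →L[ℝ] (Fin n → ℝ)) : Module.End ℝ (Fin n → ℝ)) lam hlam w fun k => ?_
    rw [Module.End.hasEigenvector_iff, Module.End.mem_eigenspace_iff]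
    exact ⟨hLw k, hw0 k⟩
  let b : Module.Basis (Fin n) ℝ (Fin n → ℝ) :=
    basisOfLinearIndependentOfCardEqFinrank' w hwli (by simp)
  have hb : ∀ k, b k = w k := fun k => by simp [b]
  have hcomm' : ∀ i j, ∀ x ∈ U, Kc i x ∘L Kc j x = Kc j x ∘L Kc i x := by
    intro i j x hx
    refine ContinuousLinearMap.ext fun y => ?_
    simp only [ContinuousLinearMap.comp_apply, hKc, Matrix.mulVec_mulVec, hcomm i j x hx]
  have hS : ∀ i j, ∀ q ∈ U, ∀ x, - Kc j q (fderiv ℝ (Kc i) q x x) + Kc i q (fderiv ℝ (Kc j) q x x)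
      - fderiv ℝ (Kc j) q (Kc i q x) x + fderiv ℝ (Kc i) q (Kc j q x) x = 0 := by
    intro i j q hq x
    have h := hsym i j (fun _ => x) contDiff_const q hq
    have hop : ∀ i, opApply (K i) (fun _ => x) = fun y => Kc i y x := by
      intro i; funext y; simp [opApply, hKc]
    have hfd : ∀ i v, fderiv ℝ (fun y => Kc i y x) q v = fderiv ℝ (Kc i) q v x := by
      intro i v
      have hd : HasFDerivAt (Kc i) (fderiv ℝ (Kc i) q) q :=
        (((hKs i).contDiffAt (hU.mem_nhds hq)).differentiableAt (by simp)).hasFDerivAt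
      rw [(hd.clm_apply (hasFDerivAt_const x q)).fderiv]
      simp
    simp only [nijBr, hop, vbracket, hfd, ← hKc, fderiv_fun_const, Pi.zero_apply, _root_.zero_apply,
      sub_self, zero_sub, sub_zero, Matrix.mulVec_zero, map_neg] at h
    rw [← h]
    abel
  obtain ⟨V, Y, hVo, hpV, hVU, hY, hYp, hYK⟩ := main_abs Kc U hU hKs hcomm' hS p hp
    (hind.map' toC (LinearMap.ker_eq_bot.2 htoCi)) c b lam hlam (fun k => by rw [hb]; exact hLw k)
  let Φ : (Fin n → ℝ) → (Fin n → ℝ) := fun y a => Y a y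
  have hΦ : ContDiffOn ℝ ∞ Φ V := contDiffOn_pi.2 hY
  let J : (Fin n → ℝ) → Matrix (Fin n) (Fin n) ℝ := fun x =>
    Matrix.of fun a b => fderiv ℝ (fun y => Φ y a) x (Pi.single b 1)
  have hJ : ∀ x a b, J x a b = fderiv ℝ (Y a) x (Pi.single b 1) := fun _ _ _ => rfl
  have hJK : ∀ x ∈ V, ∀ i, ∃ s : Fin n → ℝ, J x * K i x = Matrix.diagonal s * J x := by
    intro x hx i
    choose s hs using hYK x hx i
    refine ⟨s, ?_⟩
    ext r k
    have h1 := congrArg (fun f => f (Pi.single k 1)) (hs r)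
    simp only [ContinuousLinearMap.comp_apply, _root_.smul_apply, smul_eq_mul] at h1
    rw [jac_apply (fderiv ℝ (Y r) x) (Kc i x (Pi.single k 1))] at h1
    rw [Matrix.diagonal_mul, hJ, ← h1, Matrix.mul_apply]
    refine Finset.sum_congr rfl fun d _ => ?_
    rw [hJ, hKc]
    simp
  have hJp : (J p).det ≠ 0 := by
    have : J p * Matrix.of (fun r k => b k r) = 1 := by
      ext r k
      rw [Matrix.mul_apply]
      simp only [hJ, Matrix.of_apply]
      rw [← jac_apply (fderiv ℝ (Y r) p) (b k), hYp, Matrix.one_apply]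
      simp [Finsupp.single_apply, eq_comm]
    exact (Matrix.isUnit_det_of_right_inverse this).ne_zero
  have hJc : ContinuousAt (fun x => (J x).det) p := by
    have h1 : ContinuousAt J p := by
      refine continuousAt_pi.2 fun r => continuousAt_pi.2 fun k => ?_
      have := ((hY r).continuousOn_fderiv_of_isOpen hVo (by simp)).continuousAt (hVo.mem_nhds hpV)
      exact this.clm_apply continuousAt_const
    exact (continuous_id.matrix_det).continuousAt.comp h1
  obtain ⟨V1, hV1, hV1o, hpV1⟩ := eventually_nhds_iff.1 (hJc.eventually_ne hJp)
  have hstrict : HasStrictFDerivAt Φ (b.equivFunL : (Fin n → ℝ) →L[ℝ] (Fin n → ℝ)) p := by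
    have h1 := (hΦ.contDiffAt (hVo.mem_nhds hpV)).hasStrictFDerivAt (by simp)
    have heq : fderiv ℝ Φ p = (b.equivFunL : (Fin n → ℝ) →L[ℝ] (Fin n → ℝ)) := by
      refine ContinuousLinearMap.ext fun v => ?_
      funext a
      have h2 : HasFDerivAt (fun y => Φ y a) _ p := hasFDerivAt_pi'.1 h1.hasFDerivAt a
      have h3 := hYp a v
      rw [show Y a = fun y => Φ y a from rfl, h2.fderiv] at h3
      simpa using h3
    rw [← heq]
    exact h1
  let e := HasStrictFDerivAt.toOpenPartialHomeomorph Φ hstrict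
  have hpe : p ∈ e.source := hstrict.mem_toOpenPartialHomeomorph_source
  have hJu : ∀ x ∈ V ∩ V1 ∩ e.source, IsUnit (J x).det := fun x hx =>
    isUnit_iff_ne_zero.2 (hV1 x hx.1.2)
  refine ⟨V ∩ V1 ∩ e.source, Φ, (hVo.inter hV1o).inter e.open_source, ⟨⟨hpV, hpV1⟩, hpe⟩,
    fun x hx => hVU hx.1.1, hΦ.mono fun x hx => hx.1.1, ?_, hJu, ?_⟩
  · exact e.injOn.mono fun x hx => hx.2
  · intro x hx i r k hrk
    obtain ⟨s, hs⟩ := hJK x hx.1.1 i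
    change (J x * K i x * (J x)⁻¹) r k = 0
    rw [hs, Matrix.mul_assoc, Matrix.mul_nonsing_inv _ (hJu x hx), Matrix.mul_one,
      Matrix.diagonal_apply_ne _ hrk]
end
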